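/- arXiv:2605.05659 — 9 statements merged into one kernel-verified Lean document; each statement's English description precedes it below -/
import Mathlib

section
/- Let x_1, ..., x_M ∈ ℝ^d be pairwise distinct inputs, let z_1, ..., z_M ∈ ℝ be arbitrary scalar targets, and let σ : ℝ → ℝ be any continuous, non-mean-periodic function. Then for hidden width N = M there exist parameters u_1 ∈ ℝ^M, v_1 ∈ ℝ^d, b_1 ∈ ℝ^M, and v_2 ∈ ℝ^M such that the purely rank-1 network satisfies v_2ᵀ σ(u_1 (v_1·x_i) + b_1) = z_i for every i ∈ {1, ..., M}, i.e., it achieves exactly zero interpolation error. -/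
open MeasureTheory

/-- The integral of a real function against a signed measure, via its Jordan
decomposition. -/
noncomputable def signedIntegral (s : SignedMeasure ℝ) (f : ℝ → ℝ) : ℝ :=
  (∫ t, f t ∂s.toJordanDecomposition.posPart) - ∫ t, f t ∂s.toJordanDecomposition.negPart

/-- A continuous function `σ : ℝ → ℝ` is mean-periodic if there is a nonzero
compactly supported signed Borel measure `μ` with `∫ σ (x - t) dμ(t) = 0` for all
`x`. -/
def MeanPeriodic (σ : ℝ → ℝ) : Prop :=
  ∃ s : SignedMeasure ℝ, s ≠ 0 ∧
    (∃ Kc : Set ℝ, IsCompact Kc ∧ ∀ A : Set ℝ, MeasurableSet A → Disjoint A Kc → s A = 0) ∧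
    ∀ x : ℝ, signedIntegral s (fun t => σ (x - t)) = 0

/-- The measure with mass `max (c i) 0` at each point `y i`. -/
noncomputable def atomicMeasure {ι : Type*} [Fintype ι] (c y : ι → ℝ) : Measure ℝ :=
  ∑ i, ENNReal.ofReal (c i) • Measure.dirac (y i)

instance {ι : Type*} [Fintype ι] (c y : ι → ℝ) : IsFiniteMeasure (atomicMeasure c y) := by
  constructor
  simp [atomicMeasure, ENNReal.sum_lt_top]

theorem integral_atomicMeasure {ι : Type*} [Fintype ι] (c y : ι → ℝ) (f : ℝ → ℝ) :
    ∫ t, f t ∂atomicMeasure c y = ∑ i, max (c i) 0 * f (y i) := by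
  unfold atomicMeasure
  rw [integral_finsetSum_measure]
  · simp [integral_smul_measure, ENNReal.toReal_ofReal']
  · intro i _
    exact (integrable_dirac (by simp)).smul_measure ENNReal.ofReal_ne_top

theorem atomicMeasure_mutuallySingular {ι : Type*} [Fintype ι] (c y : ι → ℝ)
    (hy : Function.Injective y) :
    atomicMeasure c y ⟂ₘ atomicMeasure (-c) y := by
  have hfin : (y '' {i | c i ≤ 0}).Finite := (Set.toFinite _).image y
  refine ⟨y '' {i | c i ≤ 0}, hfin.measurableSet, ?_, ?_⟩
  · simp only [atomicMeasure, Measure.coe_finsetSum, Finset.sum_apply, Measure.smul_apply,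
      smul_eq_mul, Measure.dirac_apply' _ hfin.measurableSet, Finset.sum_eq_zero_iff]
    intro i _
    by_cases hi : c i ≤ 0
    · simp [ENNReal.ofReal_of_nonpos hi]
    · simp [hy.eq_iff, hi]
  · simp only [atomicMeasure, Measure.coe_finsetSum, Finset.sum_apply, Measure.smul_apply,
      smul_eq_mul, Measure.dirac_apply' _ hfin.measurableSet.compl, Finset.sum_eq_zero_iff]
    intro i _
    by_cases hi : c i ≤ 0
    · simp [hy.eq_iff, hi]
    · simp [(not_le.mp hi).le]

theorem max_zero_sub_max_neg_zero_mul (a b : ℝ) :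
    max a 0 * b - max (-a) 0 * b = a * b := by
  rw [← sub_mul]
  congr 1
  rcases le_total a 0 with h | h <;> simp [h]

/-- A nontrivial linear relation between translates of `σ` makes `σ` mean-periodic. -/
theorem MeanPeriodic.of_sum_translates_eq_zero {ι : Type*} [Fintype ι] {σ : ℝ → ℝ}
    {c t : ι → ℝ} (ht : Function.Injective t) (hc : c ≠ 0)
    (h : ∀ b, ∑ i, c i * σ (t i + b) = 0) : MeanPeriodic σ := by
  classical
  set y : ι → ℝ := fun i => -t i
  have hy : Function.Injective y := neg_injective.comp ht
  let j : JordanDecomposition ℝ :=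
    ⟨atomicMeasure c y, atomicMeasure (-c) y, atomicMeasure_mutuallySingular c y hy⟩
  have happly (A : Set ℝ) (hA : MeasurableSet A) :
      j.toSignedMeasure A = ∑ i, c i * A.indicator 1 (y i) := by
    rw [JordanDecomposition.toSignedMeasure, sub_apply,
      Measure.toSignedMeasure_apply_measurable hA, Measure.toSignedMeasure_apply_measurable hA,
      ← integral_indicator_one hA, ← integral_indicator_one hA]
    simp only [j, integral_atomicMeasure, ← Finset.sum_sub_distrib, Pi.neg_apply,
      max_zero_sub_max_neg_zero_mul]
  refine ⟨j.toSignedMeasure, ?_, ⟨Set.range y, (Set.finite_range y).isCompact, ?_⟩, ?_⟩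
  · intro h0
    obtain ⟨k, hk⟩ := Function.ne_iff.mp hc
    have := happly {y k} (measurableSet_singleton _)
    rw [h0] at this
    simp [Set.indicator_apply, hy.eq_iff] at this
    exact hk this.symm
  · intro A hA hd
    rw [happly A hA]
    refine Finset.sum_eq_zero fun i _ => ?_
    simp [Set.disjoint_right.mp hd (Set.mem_range_self i)]
  · intro x
    rw [signedIntegral, JordanDecomposition.toJordanDecomposition_toSignedMeasure]
    simp only [j, integral_atomicMeasure, ← Finset.sum_sub_distrib, Pi.neg_apply,
      max_zero_sub_max_neg_zero_mul]
    rw [← h x]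
    exact Finset.sum_congr rfl fun i _ => by simp only [y, sub_neg_eq_add, add_comm]

theorem apply_eq_sum_apply_single_mul {κ : Type*} [Fintype κ] [DecidableEq κ]
    (f : (κ → ℝ) →ₗ[ℝ] ℝ) (w : κ → ℝ) : f w = ∑ a, f (Pi.single a 1) * w a := by
  conv_lhs => rw [pi_eq_sum_univ' w, map_sum]
  refine Finset.sum_congr rfl fun a _ => ?_
  rw [map_smul, smul_eq_mul, mul_comm]

/-- Finitely many distinct points are separated by the projection onto some direction. -/
theorem exists_injective_dotProduct {ι κ : Type*} [Finite ι] [Fintype κ] {x : ι → κ → ℝ}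
    (hx : Function.Injective x) :
    ∃ v : κ → ℝ, Function.Injective fun i => ∑ a, v a * x i a := by
  classical
  obtain ⟨f, hf⟩ := Module.exists_dual_forall_apply_ne_zero (K := ℝ)
    (fun p : {p : ι × ι // p.1 ≠ p.2} => x p.1.1 - x p.1.2)
    fun p => sub_ne_zero.mpr (hx.ne p.2)
  refine ⟨fun a => f (Pi.single a 1), fun i k hik => ?_⟩
  by_contra hne
  apply hf ⟨(i, k), hne⟩
  rw [map_sub, sub_eq_zero, apply_eq_sum_apply_single_mul f, apply_eq_sum_apply_single_mul f]
  exact hik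

/-- The translates of a non-mean-periodic function, sampled at distinct points, span. -/
theorem span_translates_eq_top {ι : Type*} [Fintype ι] {σ : ℝ → ℝ} (hσ : ¬ MeanPeriodic σ)
    {t : ι → ℝ} (ht : Function.Injective t) :
    Submodule.span ℝ (Set.range fun b i => σ (t i + b)) = ⊤ := by
  classical
  by_contra hne
  obtain ⟨f, hf0, hf⟩ := Submodule.exists_le_ker_of_lt_top _ (lt_top_iff_ne_top.mpr hne)
  refine hσ (.of_sum_translates_eq_zero (c := fun i => f (Pi.single i 1)) ht ?_ fun b => ?_)
  · intro h0
    exact hf0 (LinearMap.pi_ext' fun i => LinearMap.ext_ring (congrFun h0 i))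
  · have := hf (Submodule.subset_span ⟨b, rfl⟩)
    rwa [LinearMap.mem_ker, apply_eq_sum_apply_single_mul f] at this

/-- Scalar interpolation by purely rank-1 networks: for pairwise
distinct inputs `x 1, …, x M ∈ ℝ^d`, arbitrary scalar targets `z`, and any
continuous non-mean-periodic activation `σ`, there exist parameters
`u₁ ∈ ℝ^M, v₁ ∈ ℝ^d, b₁ ∈ ℝ^M, v₂ ∈ ℝ^M` with
`v₂ᵀ σ(u₁ (v₁ ⬝ x i) + b₁) = z i` for every `i`. -/
theorem stmt4 (d M : ℕ) (x : Fin M → Fin d → ℝ) (hx : Function.Injective x)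
    (z : Fin M → ℝ) (σ : ℝ → ℝ) (hσc : Continuous σ) (hσ : ¬ MeanPeriodic σ) :
    ∃ (u1 : Fin M → ℝ) (v1 : Fin d → ℝ) (b1 : Fin M → ℝ) (v2 : Fin M → ℝ),
      ∀ i, ∑ j, v2 j * σ (u1 j * (∑ a, v1 a * x i a) + b1 j) = z i := by
  obtain ⟨v, hv⟩ := exists_injective_dotProduct hx
  have htop := span_translates_eq_top hσ hv
  obtain ⟨f, hf, hspan, -⟩ := Submodule.exists_fun_fin_finrank_span_eq ℝ
    (Set.range fun (b : ℝ) (i : Fin M) => σ ((∑ a, v a * x i a) + b))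
  have hM : Module.finrank ℝ (Submodule.span ℝ
      (Set.range fun (b : ℝ) (i : Fin M) => σ ((∑ a, v a * x i a) + b))) = M := by
    rw [htop, finrank_top, Module.finrank_fin_fun]
  choose b hb using hf
  obtain ⟨w, hw⟩ := (Submodule.mem_span_range_iff_exists_fun ℝ).mp
    (show z ∈ Submodule.span ℝ (Set.range f) by rw [hspan, htop]; trivial)
  let e := finCongr hM
  refine ⟨1, v, b ∘ e.symm, w ∘ e.symm, fun i => ?_⟩
  rw [← hw, Finset.sum_apply, ← e.sum_comp]
  simp [← hb]
end

section
/- Let ρ : ℝ → ℝ be a non-affine continuous function that is differentiable at some point c ∈ ℝ with ρ'(c) ≠ 0, applied componentwise to vectors. Let W ∈ ℝ^{N×N} and let W = ∑_{l=1}^L M_l be any decomposition of W into matrices M_l ∈ ℝ^{N×N}. Let β_1, ..., β_L be nonzero real scalars with ∑_{l=1}^L β_l = 0, and let K ⊂ ℝ^N be compact. Then, as h → 0 (h > 0), the parallel wide structure converges uniformly on K to the exact linear mapping: sup_{x ∈ K} ‖ ∑_{l=1}^L (β_l / (h ρ'(c))) ρ((h/β_l) M_l x + c 𝟙_N) − W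 x ‖ → 0. -/
/-- Rescaled difference quotients of a function differentiable at `c` with nonzero derivative
converge to the identity, uniformly on bounded sets. -/
theorem HasDerivAt.eventually_abs_rescaled_sub_lt {ρ : ℝ → ℝ} {d c : ℝ} (hρ : HasDerivAt ρ d c)
    (hd : d ≠ 0) {b : ℝ} (hb : b ≠ 0) (R : ℝ) {ε : ℝ} (hε : 0 < ε) :
    ∀ᶠ h in nhdsWithin (0 : ℝ) (Set.Ioi 0), ∀ y : ℝ, |y| ≤ R →
      |b / (h * d) * (ρ (h / b * y + c) - ρ c) - y| < ε := by
  have hd' : 0 < |d| := abs_pos.mpr hd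
  have hb' : 0 < |b| := abs_pos.mpr hb
  have hR : 0 < |R| + 1 := by positivity
  set η : ℝ := ε * |d| / (2 * (|R| + 1)) with hη
  have hη0 : 0 < η := by positivity
  have hlo := (hasDerivAt_iff_isLittleO_nhds_zero.mp hρ).def hη0
  obtain ⟨δ, hδ, hball⟩ := Metric.eventually_nhds_iff.mp hlo
  have hsmall : ∀ᶠ h in nhdsWithin (0 : ℝ) (Set.Ioi 0), h < δ * |b| / (|R| + 1) :=
    nhdsWithin_le_nhds (gt_mem_nhds (by positivity))
  filter_upwards [hsmall, self_mem_nhdsWithin] with h hh h0 y hy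
  have h0 : 0 < h := h0
  have hyR : |y| ≤ |R| + 1 := by linarith [le_abs_self R]
  have habs : |h / b * y| = h / |b| * |y| := by rw [abs_mul, abs_div, abs_of_pos h0]
  have hlt : |h / b * y| < δ := by
    rw [lt_div_iff₀ hR] at hh
    rw [habs, div_mul_eq_mul_div, div_lt_iff₀ hb']
    exact (mul_le_mul_of_nonneg_left hyR h0.le).trans_lt hh
  have hrem := hball (y := h / b * y) (by rwa [Real.dist_eq, sub_zero])
  rw [Real.norm_eq_abs, Real.norm_eq_abs, habs, smul_eq_mul, add_comm c] at hrem
  have hsplit : b / (h * d) * (ρ (h / b * y + c) - ρ c) - y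
      = b / (h * d) * (ρ (h / b * y + c) - ρ c - h / b * y * d) := by
    field_simp
  rw [hsplit, abs_mul, abs_div, abs_mul, abs_of_pos h0]
  calc |b| / (h * |d|) * |ρ (h / b * y + c) - ρ c - h / b * y * d|
      ≤ |b| / (h * |d|) * (η * (h / |b| * |y|)) := by gcongr
    _ = η / |d| * |y| := by field_simp
    _ ≤ η / |d| * (|R| + 1) := by gcongr
    _ = ε / 2 := by rw [hη]; field_simp
    _ < ε := half_lt_self hε


/-- Additive width expansion: Let `ρ` be non-affine continuous,
differentiable at `c` with `ρ'(c) ≠ 0`, applied componentwise.  Let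
`W = ∑ l, M l` be any decomposition, `β l` nonzero scalars with `∑ l, β l = 0`, and
`K` compact.  Then as `h → 0⁺`, the parallel wide structure
`x ↦ ∑ l, (β l / (h ρ'(c))) ρ((h / β l) (M l) x + c 𝟙)` converges uniformly on `K`
to `x ↦ W x`. -/
theorem stmt7 (ρ : ℝ → ℝ) (hρc : Continuous ρ)
    (hna : ¬ ∃ a b : ℝ, ∀ x, ρ x = a * x + b)
    (c : ℝ) (hdiff : DifferentiableAt ℝ ρ c) (hd : deriv ρ c ≠ 0)
    (N L : ℕ) (W : Matrix (Fin N) (Fin N) ℝ) (Ml : Fin L → Matrix (Fin N) (Fin N) ℝ)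
    (hW : W = ∑ l, Ml l)
    (β : Fin L → ℝ) (hβ : ∀ l, β l ≠ 0) (hβ0 : ∑ l, β l = 0)
    (K : Set (Fin N → ℝ)) (hK : IsCompact K) :
    TendstoUniformlyOn
      (fun h x => fun i : Fin N =>
        ∑ l, (β l / (h * deriv ρ c)) * ρ ((h / β l) * (Ml l).mulVec x i + c))
      (fun x => W.mulVec x) (nhdsWithin 0 (Set.Ioi 0)) K := by
  have hcont : Continuous fun (x : Fin N → ℝ) (l : Fin L) => (Ml l).mulVec x :=
    continuous_pi fun l => continuous_const.matrix_mulVec continuous_id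
  obtain ⟨R, hR⟩ := hK.exists_bound_of_continuousOn hcont.continuousOn
  rw [Metric.tendstoUniformlyOn_iff]
  intro ε hε
  have hL : (0 : ℝ) < L + 1 := by positivity
  have hev := Filter.eventually_all.mpr fun l =>
    hdiff.hasDerivAt.eventually_abs_rescaled_sub_lt hd (hβ l) R (div_pos hε hL)
  filter_upwards [hev] with h hh x hx
  rw [dist_comm, dist_pi_lt_iff hε]
  intro i
  have hbound : ∀ l, |(Ml l).mulVec x i| ≤ R := fun l =>
    ((norm_le_pi_norm ((Ml l).mulVec x) i).trans
      (norm_le_pi_norm (fun l => (Ml l).mulVec x) l)).trans (hR x hx)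
  have hconst : ∑ l, β l / (h * deriv ρ c) * ρ c = 0 := by
    rw [← Finset.sum_mul, ← Finset.sum_div, hβ0, zero_div, zero_mul]
  have hlin : W.mulVec x i = ∑ l, (Ml l).mulVec x i := by
    rw [hW, Matrix.sum_mulVec, Finset.sum_apply]
  have herr : ∑ l, β l / (h * deriv ρ c) * ρ (h / β l * (Ml l).mulVec x i + c) - W.mulVec x i
      = ∑ l, (β l / (h * deriv ρ c) * (ρ (h / β l * (Ml l).mulVec x i + c) - ρ c)
          - (Ml l).mulVec x i) := by
    simp only [mul_sub, Finset.sum_sub_distrib, hconst, hlin, sub_zero]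
  rw [Real.dist_eq, herr]
  calc _ ≤ ∑ l, |β l / (h * deriv ρ c) * (ρ (h / β l * (Ml l).mulVec x i + c) - ρ c)
          - (Ml l).mulVec x i| := Finset.abs_sum_le_sum_abs _ _
    _ ≤ ∑ _l : Fin L, ε / (L + 1) := Finset.sum_le_sum fun l _ => (hh l _ (hbound l)).le
    _ = L * (ε / (L + 1)) := by simp
    _ < (L + 1) * (ε / (L + 1)) := by gcongr; linarith
    _ = ε := mul_div_cancel₀ _ hL.ne'
end

section
/- Let ρ : ℝ → ℝ be a non-affine continuous function that is differentiable at some point c ∈ ℝ with ρ'(c) ≠ 0. Define, for h > 0, the scalar affine functions Φ_h(x) = h x + c and Ψ_h(y) = (y − ρ(c)) / (h ρ'(c)). Then for every compact set K ⊂ ℝ, the composition Ψ_h ∘ ρ ∘ Φ_h converges uniformly on K to the identity function as h → 0: sup_{x ∈ K} |Ψ_h(ρ(Φ_h(x))) − x| → 0. -/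
/-- Identity approximation, Lemma 4.1 of Kidger–Lyons: Let `ρ` be a
non-affine continuous function differentiable at some `c` with `ρ'(c) ≠ 0`.  With
`Φ_h(x) = h x + c` and `Ψ_h(y) = (y - ρ(c)) / (h ρ'(c))`, the composition
`Ψ_h ∘ ρ ∘ Φ_h` converges uniformly to the identity on every compact `K ⊆ ℝ` as
`h → 0⁺`. -/
theorem stmt8 (ρ : ℝ → ℝ) (hρc : Continuous ρ)
    (hna : ¬ ∃ a b : ℝ, ∀ x, ρ x = a * x + b)
    (c : ℝ) (hdiff : DifferentiableAt ℝ ρ c) (hd : deriv ρ c ≠ 0)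
    (K : Set ℝ) (hK : IsCompact K) :
    TendstoUniformlyOn (fun h x => (ρ (h * x + c) - ρ c) / (h * deriv ρ c))
      (fun x => x) (nhdsWithin 0 (Set.Ioi 0)) K := by
  obtain ⟨M, hM, hKM⟩ := hK.isBounded.exists_pos_norm_le
  have hd' : 0 < |deriv ρ c| := abs_pos.mpr hd
  rw [Metric.tendstoUniformlyOn_iff]
  intro ε hε
  have hη : 0 < ε * |deriv ρ c| / (2 * M) := by positivity
  have ho := (hasDerivAt_iff_isLittleO_nhds_zero.mp hdiff.hasDerivAt).def hη
  obtain ⟨δ, hδ, hball⟩ := Metric.eventually_nhds_iff.mp ho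
  filter_upwards [Ioo_mem_nhdsGT (div_pos hδ hM)] with h ⟨h0, hlt⟩ x hx
  have hxM : |x| ≤ M := hKM x hx
  have hhM : h * |x| ≤ h * M := by gcongr
  have hsmall : h * |x| < δ := hhM.trans_lt ((lt_div_iff₀ hM).mp hlt)
  have hb := @hball (h * x) (by simpa [abs_mul, abs_of_pos h0] using hsmall)
  simp only [Real.norm_eq_abs, smul_eq_mul, abs_mul, abs_of_pos h0] at hb
  have herr : (ρ (h * x + c) - ρ c) / (h * deriv ρ c) - x
      = (ρ (c + h * x) - ρ c - h * x * deriv ρ c) / (h * deriv ρ c) := by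
    rw [add_comm c]
    field_simp [h0.ne']
  rw [dist_comm, Real.dist_eq, herr, abs_div, abs_mul, abs_of_pos h0,
    div_lt_iff₀ (mul_pos h0 hd')]
  calc _ ≤ ε * |deriv ρ c| / (2 * M) * (h * |x|) := hb
    _ ≤ ε * |deriv ρ c| / (2 * M) * (h * M) := by gcongr
    _ = ε * (h * |deriv ρ c|) / 2 := by field_simp
    _ < ε * (h * |deriv ρ c|) := half_lt_self (by positivity)
end

section
/- Let W ∈ ℝ^{N×N} be invertible and let 1 ≤ r ≤ N with L = ⌈N/r⌉. Then there exist a nonzero scalar α ∈ ℝ and matrices U_l, V_l ∈ ℝ^{N×r_l} with r_l ≤ r for l = 1, ..., L, such that W = ∏_{l=1}^L (α I_N + U_l V_lᵀ); that is, every invertible matrix factors exactly as a product of L DLoR components each of whose low-rank part has rank at most r. -/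
open Matrix

/-- For two vectors outside a subspace, some dual vector annihilates the subspace and is nonzero
at both vectors. -/
theorem Submodule.exists_dual_le_ker_ne_zero_ne_zero {K E : Type*} [Field K] [AddCommGroup E]
    [Module K E] (F : Submodule K E) {x y : E} (hx : x ∉ F) (hy : y ∉ F) :
    ∃ f : E →ₗ[K] K, F ≤ LinearMap.ker f ∧ f x ≠ 0 ∧ f y ≠ 0 := by
  obtain ⟨f, hfx, hf⟩ := F.exists_le_ker_of_notMem hx
  obtain ⟨g, hgy, hg⟩ := F.exists_le_ker_of_notMem hy
  by_cases hfy : f y = 0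
  · by_cases hgx : g x = 0
    · refine ⟨f + g, fun z hz => ?_, by simpa [hgx] using hfx, by simpa [hfy] using hgy⟩
      have h₁ : f z = 0 := hf hz
      have h₂ : g z = 0 := hg hz
      simp [h₁, h₂]
    · exact ⟨g, hg, hgx, hgy⟩
  · exact ⟨f, hf, hfx, hfy⟩

namespace Matrix

variable {K n : Type*} [Field K] [Fintype n] [DecidableEq n]

theorem det_one_add_vecMulVec (u v : n → K) : (1 + vecMulVec u v).det = 1 + v ⬝ᵥ u := by
  rw [vecMulVec_eq Unit, det_one_add_replicateCol_mul_replicateRow]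

theorem one_add_vecMulVec_mulVec (u v x : n → K) :
    (1 + vecMulVec u v) *ᵥ x = x + (v ⬝ᵥ x) • u := by
  rw [add_mulVec, one_mulVec, vecMulVec_mulVec]
  ext i
  simp [mul_comm]

/-- An invertible matrix `A ≠ 1` splits off a rank-one perturbation of the identity, lowering the
rank of its difference from the identity. -/
theorem exists_eq_one_add_vecMulVec_mul (A : Matrix n n K) (hA : IsUnit A.det) {k : ℕ}
    (hk : (A - 1).rank ≤ k + 1) :
    ∃ (u v : n → K) (B : Matrix n n K),
      A = (1 + vecMulVec u v) * B ∧ IsUnit B.det ∧ (B - 1).rank ≤ k := by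
  set F := LinearMap.ker (A - 1).mulVecLin with hF
  have memF (z : n → K) : z ∈ F ↔ A *ᵥ z = z := by
    simp [hF, sub_eq_zero]
  by_cases hall : ∀ x, A *ᵥ x = x
  · have hA1 : A = 1 := ext_of_mulVec_single fun i => by rw [hall, one_mulVec]
    exact ⟨0, 0, 1, by simp [hA1], by simp, by simp⟩
  push Not at hall
  obtain ⟨x, hx⟩ := hall
  have hinj : Function.Injective A.mulVec :=
    mulVec_injective_of_isUnit ((isUnit_iff_isUnit_det A).2 hA)
  obtain ⟨f, hfF, hfx, hfy⟩ := F.exists_dual_le_ker_ne_zero_ne_zero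
    (x := x) (y := A *ᵥ x) (fun h => hx ((memF x).1 h)) (fun h => hx (hinj ((memF _).1 h)))
  set w : n → K := (f x)⁻¹ • (dotProductEquiv K n).symm f with hw
  have hwf (z : n → K) : w ⬝ᵥ z = (f x)⁻¹ * f z := by
    have h : dotProductEquiv K n ((dotProductEquiv K n).symm f) z = f z := by
      rw [LinearEquiv.apply_symm_apply]
    rw [dotProductEquiv_apply_apply] at h
    rw [hw, smul_dotProduct, h, smul_eq_mul]
  set C := 1 + vecMulVec (A *ᵥ x - x) w with hC
  have hCdet : IsUnit C.det := by
    rw [hC, det_one_add_vecMulVec, dotProduct_sub, hwf, hwf, inv_mul_cancel₀ hfx,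
      add_sub_cancel, isUnit_iff_ne_zero]
    exact mul_ne_zero (inv_ne_zero hfx) hfy
  have hCA : A = C * (C⁻¹ * A) := by rw [mul_nonsing_inv_cancel_left _ _ hCdet]
  have hfix {z : n → K} (h : C *ᵥ z = A *ᵥ z) : (C⁻¹ * A - 1) *ᵥ z = 0 := by
    rw [sub_mulVec, one_mulVec, ← mulVec_mulVec, ← h, mulVec_mulVec, nonsing_inv_mul _ hCdet,
      one_mulVec, sub_self]
  refine ⟨_, _, C⁻¹ * A, hCA, ?_, ?_⟩
  · rw [det_mul]
    exact (isUnit_nonsing_inv_det _ hCdet).mul hA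
  have hlt : F < LinearMap.ker (C⁻¹ * A - 1).mulVecLin := by
    refine lt_of_le_of_ne (fun z hz => hfix ?_) fun h => hx ((memF x).1 ?_)
    · have hz0 : f z = 0 := hfF hz
      rw [hC, one_add_vecMulVec_mulVec, hwf, hz0, (memF z).1 hz]
      simp
    · rw [h]
      refine hfix ?_
      rw [hC, one_add_vecMulVec_mulVec, hwf, inv_mul_cancel₀ hfx]
      simp
  have h₁ := Submodule.finrank_lt_finrank_of_lt hlt
  have h₂ := (A - 1).mulVecLin.finrank_range_add_finrank_ker
  have h₃ := (C⁻¹ * A - 1).mulVecLin.finrank_range_add_finrank_ker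
  rw [← hF] at h₂
  rw [rank] at hk ⊢
  omega

/-- A product of a rank-one perturbation and a rank-`r` perturbation of the identity is a
rank-`(r + 1)` perturbation of the identity. -/
theorem exists_one_add_vecMulVec_mul_eq {r : ℕ} (u v : n → K) (U V : Matrix n (Fin r) K) :
    ∃ U' V' : Matrix n (Fin (r + 1)) K,
      (1 + vecMulVec u v) * (1 + U * Vᵀ) = 1 + U' * V'ᵀ := by
  refine ⟨of fun i => Fin.cons (u i) (U i),
    of fun i => Fin.cons ((v ᵥ* (1 + U * Vᵀ)) i) (V i), ?_⟩
  rw [add_mul, one_mul, vecMulVec_mul, add_assoc, add_right_inj]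
  ext i j
  simp [mul_apply, vecMulVec_apply, Fin.sum_univ_succ, add_comm]

theorem exists_eq_one_add_mul_transpose_mul (r : ℕ) (A : Matrix n n K) (hA : IsUnit A.det) {k : ℕ}
    (hk : (A - 1).rank ≤ k + r) :
    ∃ (U V : Matrix n (Fin r) K) (B : Matrix n n K),
      A = (1 + U * Vᵀ) * B ∧ IsUnit B.det ∧ (B - 1).rank ≤ k := by
  induction r generalizing A with
  | zero => exact ⟨0, 0, A, by simp, hA, hk⟩
  | succ r ih =>
    obtain ⟨u, v, A', rfl, hA', hk'⟩ := exists_eq_one_add_vecMulVec_mul A hA (k := k + r) hk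
    obtain ⟨U, V, B, rfl, hB, hkB⟩ := ih A' hA' hk'
    obtain ⟨U', V', h⟩ := exists_one_add_vecMulVec_mul_eq u v U V
    exact ⟨U', V', B, by rw [← h, mul_assoc], hB, hkB⟩

theorem exists_eq_prod_one_add_mul_transpose (r L : ℕ) (A : Matrix n n K) (hA : IsUnit A.det)
    (hk : (A - 1).rank ≤ L * r) :
    ∃ U V : Fin L → Matrix n (Fin r) K,
      A = (List.ofFn fun l => 1 + U l * (V l)ᵀ).reverse.prod := by
  induction L generalizing A with
  | zero =>
    refine ⟨0, 0, ?_⟩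
    have h : (A - 1).mulVecLin = 0 := by
      rw [← LinearMap.range_eq_bot, ← Submodule.finrank_eq_zero (R := K)]
      rw [rank] at hk
      lia
    have h' : A - 1 = 0 := ext_of_mulVec_single fun i => by
      rw [← mulVecLin_apply, h, LinearMap.zero_apply, zero_mulVec]
    simpa using sub_eq_zero.1 h'
  | succ L ih =>
    obtain ⟨U, V, B, rfl, hB, hkB⟩ :=
      exists_eq_one_add_mul_transpose_mul r A hA (k := L * r) (by rwa [← Nat.succ_mul])
    obtain ⟨Us, Vs, rfl⟩ := ih B hB hkB
    refine ⟨Fin.snoc Us U, Fin.snoc Vs V, ?_⟩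
    rw [List.ofFn_succ_last]
    simp

end Matrix

/-- Multiplicative DLoR factorization: every invertible
`W ∈ ℝ^{N×N}` factors, for any rank constraint `1 ≤ r ≤ N` and `L = ⌈N/r⌉`, as a
product `W = M_L ⋯ M_1` of DLoR components `M_l = α I + U_l V_lᵀ` with a common
nonzero scalar `α` and `U_l, V_l ∈ ℝ^{N × r_l}`, `r_l ≤ r`. -/
theorem stmt9 (N r : ℕ) (hr1 : 1 ≤ r) (hrN : r ≤ N)
    (W : Matrix (Fin N) (Fin N) ℝ) (hW : IsUnit W.det) :
    ∃ α : ℝ, α ≠ 0 ∧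
      ∃ rk : Fin (N ⌈/⌉ r) → ℕ, (∀ l, rk l ≤ r) ∧
        ∃ U V : (l : Fin (N ⌈/⌉ r)) → Matrix (Fin N) (Fin (rk l)) ℝ,
          W = (List.ofFn fun l =>
                α • (1 : Matrix (Fin N) (Fin N) ℝ) + U l * (V l)ᵀ).reverse.prod := by
  have hk : (W - 1).rank ≤ (N ⌈/⌉ r) * r := by
    have h : N ≤ r * (N ⌈/⌉ r) := le_smul_ceilDiv (a := r) hr1
    rw [mul_comm]
    exact ((W - 1).rank_le_width).trans h
  obtain ⟨U, V, h⟩ := exists_eq_prod_one_add_mul_transpose r (N ⌈/⌉ r) W hW hk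
  exact ⟨1, one_ne_zero, fun _ => r, fun _ => le_rfl, U, V, by simpa only [one_smul] using h⟩
end

section
/- Let W ∈ ℝ^{N×N} be invertible, let r_1, ..., r_L be positive integers with r_1 + ... + r_L = N, and set s_k = r_1 + ... + r_k. Then there exists an invertible matrix Z ∈ ℝ^{N×N} such that for every k ∈ {1, ..., L−1}, the N × N block matrix whose first s_k columns are the first s_k columns of W Z and whose remaining N − s_k columns are the last N − s_k columns of Z has nonzero determinant (is invertible). -/
open MvPolynomial in
/-- The determinant of the matrix whose first `s` columns are those of `W * Z` and whose other
columns are those of `Z`, as a polynomial in the entries of `Z`. -/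
noncomputable def mixedColumnsDet {N : ℕ} (W : Matrix (Fin N) (Fin N) ℝ) (s : ℕ) :
    MvPolynomial (Fin N × Fin N) ℝ :=
  (Matrix.of fun i j : Fin N =>
    if (j : ℕ) < s then ∑ k, C (W i k) * X (k, j) else X (i, j)).det

theorem eval_mixedColumnsDet {N : ℕ} (W Z : Matrix (Fin N) (Fin N) ℝ) (s : ℕ) :
    MvPolynomial.eval (fun p => Z p.1 p.2) (mixedColumnsDet W s) =
      (Matrix.of fun i j : Fin N => if (j : ℕ) < s then (W * Z) i j else Z i j).det := by
  rw [mixedColumnsDet, RingHom.map_det]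
  congr 1
  ext i j
  by_cases h : (j : ℕ) < s <;> simp [h, Matrix.mul_apply]

theorem mixedColumnsDet_ne_zero {N : ℕ} {W : Matrix (Fin N) (Fin N) ℝ} (hW : IsUnit W.det)
    (s : ℕ) : mixedColumnsDet W s ≠ 0 := by
  intro h
  let Z : Matrix (Fin N) (Fin N) ℝ :=
    Matrix.of fun i j => if (j : ℕ) < s then W⁻¹ i j else (1 : Matrix (Fin N) (Fin N) ℝ) i j
  have key := eval_mixedColumnsDet W Z s
  have hone : (Matrix.of fun i j : Fin N => if (j : ℕ) < s then (W * Z) i j else Z i j) = 1 := by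
    ext i j
    by_cases hj : (j : ℕ) < s
    · rw [← Matrix.mul_nonsing_inv W hW]
      simp [hj, Z, Matrix.mul_apply]
    · simp [hj, Z]
  rw [h, hone] at key
  simp at key

/-- Finitely many column splittings admit a common generic matrix. -/
theorem exists_forall_mixedColumns_det_ne_zero {N : ℕ} {W : Matrix (Fin N) (Fin N) ℝ}
    (hW : IsUnit W.det) (S : Finset ℕ) :
    ∃ Z : Matrix (Fin N) (Fin N) ℝ, ∀ s ∈ S,
      (Matrix.of fun i j : Fin N => if (j : ℕ) < s then (W * Z) i j else Z i j).det ≠ 0 := by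
  have hprod : ∏ s ∈ S, mixedColumnsDet W s ≠ 0 :=
    Finset.prod_ne_zero_iff.mpr fun s _ => mixedColumnsDet_ne_zero hW s
  obtain ⟨x, hx⟩ : ∃ x, MvPolynomial.eval x (∏ s ∈ S, mixedColumnsDet W s) ≠ 0 := by
    by_contra! h
    exact hprod (MvPolynomial.funext fun x => by simpa using h x)
  rw [map_prod, Finset.prod_ne_zero_iff] at hx
  refine ⟨Matrix.of fun i j => x (i, j), fun s hs => ?_⟩
  rw [← eval_mixedColumnsDet]
  exact hx s hs


/-- Existence of a simultaneously generic change of basis: for an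
invertible `W ∈ ℝ^{N×N}` and positive integers `r 1, …, r L` summing to `N`, with
partial sums `s k = r 1 + ⋯ + r k`, there is an invertible `Z` such that for every
`k ∈ {1, …, L-1}` the block matrix whose first `s k` columns are those of `W * Z`
and whose remaining columns are the last `N - s k` columns of `Z` has nonzero
determinant. -/
theorem stmt10 (N L : ℕ) (W : Matrix (Fin N) (Fin N) ℝ) (hW : IsUnit W.det)
    (r : Fin L → ℕ) (hr : ∀ l, 0 < r l) (hsum : ∑ l, r l = N) :
    ∃ Z : Matrix (Fin N) (Fin N) ℝ, IsUnit Z.det ∧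
      ∀ k : ℕ, 1 ≤ k → k ≤ L - 1 →
        (Matrix.of fun i j : Fin N =>
          if (j : ℕ) < ∑ l : Fin L, (if (l : ℕ) < k then r l else 0)
          then (W * Z) i j else Z i j).det ≠ 0 := by
  obtain ⟨Z, hZ⟩ := exists_forall_mixedColumns_det_ne_zero hW
    ((Finset.range (L + 1)).image fun k => ∑ l : Fin L, if (l : ℕ) < k then r l else 0)
  refine ⟨Z, isUnit_iff_ne_zero.mpr ?_, fun k _ hk => ?_⟩
  · have h := hZ 0 (Finset.mem_image.mpr ⟨0, by simp, by simp⟩)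
    simp only [Nat.not_lt_zero, if_false] at h
    exact h
  · exact hZ _ (Finset.mem_image_of_mem _ (Finset.mem_range.mpr (by omega)))
end

section
/- Let ρ : ℝ → ℝ be a non-affine continuous function that is differentiable at some point c ∈ ℝ with ρ'(c) ≠ 0, applied componentwise. Define Φ_h(x) = h x + c and Ψ_h(y) = (y − ρ(c)) / (h ρ'(c)), applied componentwise to vectors. Let W ∈ ℝ^{N×N} be invertible with a factorization W = M_L · M_{L−1} · ... · M_1 into matrices M_l ∈ ℝ^{N×N}, let b ∈ ℝ^N, and let K ⊂ ℝ^N be compact. Then the deep sequential structure converges uniformly on K to the exact dense layer: sup_{x ∈ K} ‖ ρ( M_L (Ψ_h ∘ ρ ∘ Φ_h) ( M_{L−1} ( ... (Ψ_h ∘ ρ ∘ Φ_h)( M_1 x ) ... ) ) + b ) − ρ(W x + b) ‖ → 0 as h → 0. -/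
/-- The identity-approximation block `Ψ_h ∘ ρ ∘ Φ_h` applied componentwise, where
`Φ_h(x) = h x + c` and `Ψ_h(y) = (y - ρ(c)) / (h ρ'(c))`. -/
noncomputable def idApprox (ρ : ℝ → ℝ) (c h : ℝ) {N : ℕ} (z : Fin N → ℝ) : Fin N → ℝ :=
  fun i => (ρ (h * z i + c) - ρ c) / (h * deriv ρ c)

open Filter Topology

/-- The identity-approximation block converges continuously to the identity: `h` may tend to `0`
while its argument varies. -/
theorem tendsto_idApprox {α : Type*} {l : Filter α} {ρ : ℝ → ℝ} {c : ℝ}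
    (hdiff : DifferentiableAt ℝ ρ c) (hd : deriv ρ c ≠ 0) {N : ℕ} {t : α → ℝ}
    (ht : Tendsto t l (𝓝[≠] 0)) {z : α → Fin N → ℝ} {w : Fin N → ℝ}
    (hz : Tendsto z l (𝓝 w)) :
    Tendsto (fun a => idApprox ρ c (t a) (z a)) l (𝓝 w) := by
  obtain ⟨ht0, hne⟩ := tendsto_nhdsWithin_iff.1 ht
  rw [tendsto_pi_nhds] at hz ⊢
  intro i
  have harg : Tendsto (fun a => t a * z a i + c) l (𝓝 c) := by
    simpa using (ht0.mul (hz i)).add_const c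
  have hslope := (continuousAt_dslope_same.2 hdiff).tendsto.comp harg
  rw [dslope_same] at hslope
  have hlim := ((hz i).mul hslope).div_const (deriv ρ c)
  rw [mul_div_cancel_right₀ _ hd] at hlim
  refine hlim.congr' ?_
  filter_upwards [hne] with a ha
  have ha0 : t a ≠ 0 := ha
  have hsub := sub_smul_dslope ρ c (t a * z a i + c)
  rw [add_sub_cancel_right, smul_eq_mul] at hsub
  simp only [idApprox, Function.comp_apply, ← hsub]
  field_simp

/-- The alternating composition of linear maps and identity-approximation blocks converges
continuously to the product of the linear maps. -/
theorem tendsto_foldl_idApprox {α : Type*} {l : Filter α} {ρ : ℝ → ℝ} {c : ℝ}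
    (hdiff : DifferentiableAt ℝ ρ c) (hd : deriv ρ c ≠ 0) {N : ℕ} {t : α → ℝ}
    (ht : Tendsto t l (𝓝[≠] 0)) (Ms : List (Matrix (Fin N) (Fin N) ℝ))
    {z : α → Fin N → ℝ} {w : Fin N → ℝ} (hz : Tendsto z l (𝓝 w)) :
    Tendsto (fun a => Ms.foldl (fun s A => idApprox ρ c (t a) (A.mulVec s)) (z a)) l
      (𝓝 (Ms.reverse.prod.mulVec w)) := by
  induction Ms generalizing z w with
  | nil => simpa using hz
  | cons A Ms ih =>
    have hA : Continuous fun v : Fin N → ℝ => A.mulVec v := by fun_prop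
    simpa [Matrix.mulVec_mulVec] using
      ih (tendsto_idApprox hdiff hd ht ((hA.tendsto w).comp hz))

/-- Multiplicative depth extension, convergence: Let `ρ` be
non-affine continuous, differentiable at `c` with `ρ'(c) ≠ 0`, applied
componentwise.  Let `W` be invertible with factorization `W = M_L ⋯ M_1`
(here `Minit = [M_1, …, M_{L-1}]` and `Mlast = M_L`), `b ∈ ℝ^N`, `K` compact.
Then `x ↦ ρ(M_L (Ψ_h∘ρ∘Φ_h)(M_{L-1} ⋯ (Ψ_h∘ρ∘Φ_h)(M_1 x) ⋯) + b)` converges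
uniformly on `K` to `x ↦ ρ(W x + b)` as `h → 0⁺`. -/
theorem stmt11 (ρ : ℝ → ℝ) (hρc : Continuous ρ)
    (hna : ¬ ∃ a b : ℝ, ∀ x, ρ x = a * x + b)
    (c : ℝ) (hdiff : DifferentiableAt ℝ ρ c) (hd : deriv ρ c ≠ 0)
    (N : ℕ) (W : Matrix (Fin N) (Fin N) ℝ) (hWu : IsUnit W.det)
    (Minit : List (Matrix (Fin N) (Fin N) ℝ)) (Mlast : Matrix (Fin N) (Fin N) ℝ)
    (hfact : W = Mlast * Minit.reverse.prod)
    (b : Fin N → ℝ) (K : Set (Fin N → ℝ)) (hK : IsCompact K) :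
    TendstoUniformlyOn
      (fun h x => fun i : Fin N =>
        ρ (Mlast.mulVec (Minit.foldl (fun s A => idApprox ρ c h (A.mulVec s)) x) i + b i))
      (fun x => fun i : Fin N => ρ (W.mulVec x i + b i))
      (nhdsWithin 0 (Set.Ioi 0)) K := by
  subst hfact
  rw [← tendstoLocallyUniformlyOn_iff_tendstoUniformlyOn_of_compact hK,
    tendstoLocallyUniformlyOn_iff_forall_tendsto]
  intro x _
  have ht : Tendsto (Prod.fst : ℝ × (Fin N → ℝ) → ℝ) (𝓝[>] 0 ×ˢ 𝓝[K] x) (𝓝[≠] 0) :=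
    tendsto_fst.mono_right (nhdsWithin_mono _ fun _ hy => ne_of_gt hy)
  have hz : Tendsto (Prod.snd : ℝ × (Fin N → ℝ) → _) (𝓝[>] 0 ×ˢ 𝓝[K] x) (𝓝 x) :=
    tendsto_snd.mono_right nhdsWithin_le_nhds
  have hlast : Continuous fun v : Fin N → ℝ => fun i => ρ (Mlast.mulVec v i + b i) := by
    fun_prop
  have hlim : Continuous fun v : Fin N → ℝ =>
      fun i => ρ ((Mlast * Minit.reverse.prod).mulVec v i + b i) := by
    fun_prop
  have happrox := (hlast.tendsto _).comp (tendsto_foldl_idApprox hdiff hd ht Minit hz)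
  rw [Matrix.mulVec_mulVec] at happrox
  exact (((hlim.tendsto x).comp hz).prodMk_nhds happrox).mono_right (nhds_le_uniformity _)
end

section
/- Let ρ : ℝ → ℝ be a non-affine continuous function that is differentiable at some point c ∈ ℝ with ρ'(c) ≠ 0, applied componentwise. Let K ⊂ ℝ^n be compact, f : K → ℝ^m continuous, and ε > 0. Set N = n + m + 2. Then there exist a depth D ≥ 1, scalars α_1, ..., α_D ∈ ℝ, vectors u_l, v_l ∈ ℝ^N and biases b_l ∈ ℝ^N for l = 1, ..., D, and a linear readout C ∈ ℝ^{m×N}, such that the deep DLoR network f̂(x) = C (ℓ_D ∘ ℓ_{D−1} ∘ ... ∘ ℓ_1)(ι(x)), where ι : ℝ^n → ℝ^N pads x with zeros and each layer is ℓ_l(z) = ρ((α_l I_N + u_l v_lᵀ) z + b_l), satisfies sup_{x ∈ K} ‖f̂(x) − f(x)‖ < ε. In other words, deep networks with every hidden weight matrix constrained to the DLoR form α I_N + u vᵀ (rank-1 low-rank part) and strictly bounded width N = n + m + 2 are dense in C(K, ℝ^m) with respect to the uniform norm. -/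
/-- Zero-padding of a vector in `ℝ^n` into `ℝ^N`. -/
def padInput (n N : ℕ) (x : Fin n → ℝ) : Fin N → ℝ :=
  fun j => if h : (j : ℕ) < n then x ⟨j, h⟩ else 0

/-- Forward pass of a deep DLoR network on `ℝ^N`: each layer is described by data
`(α, u, v, b)` and computes `z ↦ ρ((α I + u vᵀ) z + b)` with `ρ` applied
componentwise. -/
noncomputable def dlorForward (ρ : ℝ → ℝ) {N : ℕ}
    (layers : List (ℝ × (Fin N → ℝ) × (Fin N → ℝ) × (Fin N → ℝ))) (z : Fin N → ℝ) :
    Fin N → ℝ :=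
  layers.foldl
    (fun s p => fun i =>
      ρ (((p.1 • (1 : Matrix (Fin N) (Fin N) ℝ) +
            Matrix.vecMulVec p.2.1 p.2.2.1).mulVec s) i + p.2.2.2 i))
    z

open Filter Topology

section Squares

/-- A continuous family of maps whose members away from the parameter `0` lie in a closed set
has its member at `0` in that set as well. -/
theorem curry_zero_mem_of_forall_ne {X Y : Type*} [TopologicalSpace X] [TopologicalSpace Y]
    {S : Set C(X, Y)} (hS : IsClosed S) (Φ : C(ℝ × X, Y))
    (h : ∀ r : ℝ, r ≠ 0 → Φ.curry r ∈ S) : Φ.curry 0 ∈ S := by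
  have h0 : (0 : ℝ) ∈ closure ({0}ᶜ : Set ℝ) := dense_compl_singleton (0 : ℝ) 0
  have := map_mem_closure Φ.curry.continuous h0 (t := S) (fun r hr => h r hr)
  rwa [hS.closure_eq] at this

/-- A closed subspace of `C(X, ℝ)` is stable under integration over a parameter. -/
theorem mem_of_eq_intervalIntegral {X : Type*} [TopologicalSpace X]
    {V : Submodule ℝ C(X, ℝ)} (hV : IsClosed (V : Set C(X, ℝ))) (Φ : C(ℝ × X, ℝ))
    (h : ∀ s, Φ.curry s ∈ V) (δ : ℝ) (g : C(X, ℝ))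
    (hg : ∀ x, g x = ∫ s in (0 : ℝ)..δ, Φ (s, x)) : g ∈ V := by
  set a : ℕ → ℕ → ℝ := fun N k => δ * (k / (N + 1 : ℝ)) with ha
  set S : ℕ → C(X, ℝ) := fun N => ∑ k ∈ Finset.range (N + 1), (δ / (N + 1 : ℝ)) • Φ.curry (a N k)
    with hSdef
  have hSV : ∀ N, S N ∈ V := fun N => V.sum_mem fun k _ => V.smul_mem _ (h _)
  refine hV.mem_of_tendsto (b := atTop) (f := S) ?_ (Eventually.of_forall hSV)
  rw [ContinuousMap.tendsto_iff_forall_isCompact_tendstoUniformlyOn]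
  intro K hK
  rw [Metric.tendstoUniformlyOn_iff]
  intro ε hε
  set η := ε / (|δ| + 1) with hη
  have hη0 : 0 < η := by positivity
  have hmul : η * |δ| < ε := by
    rw [hη, div_mul_eq_mul_div, div_lt_iff₀ (by positivity)]
    nlinarith [abs_nonneg δ]
  -- compactness in `x` makes the family uniformly continuous in the parameter
  have huc : ∃ d > 0, ∀ s ∈ Set.uIcc 0 δ, ∀ s' ∈ Set.uIcc 0 δ, |s - s'| < d →
      ∀ x ∈ K, |Φ (s, x) - Φ (s', x)| < η := by
    let R : C(C(X, ℝ), C(K, ℝ)) := ContinuousMap.compRightContinuousMap ℝ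
      ⟨((↑) : K → X), continuous_subtype_val⟩
    have : CompactSpace K := isCompact_iff_compactSpace.mp hK
    have hc : Continuous fun s : ℝ => R (Φ.curry s) := R.continuous.comp Φ.curry.continuous
    have := (isCompact_uIcc (a := (0 : ℝ)) (b := δ)).uniformContinuousOn_of_continuous
      hc.continuousOn
    rw [Metric.uniformContinuousOn_iff] at this
    obtain ⟨d, hd, H⟩ := this η hη0
    refine ⟨d, hd, fun s hs s' hs' hss x hx => ?_⟩
    have := H s hs s' hs' (by simpa [Real.dist_eq] using hss)
    exact (ContinuousMap.dist_apply_le_dist (⟨x, hx⟩ : K)).trans_lt this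
  obtain ⟨d, hd, H⟩ := huc
  obtain ⟨N₀, hN₀⟩ := exists_nat_gt (|δ| / d)
  filter_upwards [eventually_ge_atTop N₀] with N hN x hx
  have hN1 : (0 : ℝ) < N + 1 := by positivity
  have hstep : ∀ k, a N (k + 1) - a N k = δ / (N + 1) := by
    intro k; simp only [ha]; push_cast; field_simp; ring
  have hsmall : |δ / (N + 1 : ℝ)| < d := by
    rw [abs_div, abs_of_pos hN1, div_lt_iff₀ hN1]
    rw [div_lt_iff₀ hd] at hN₀
    have : (N₀ : ℝ) ≤ N := by exact_mod_cast hN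
    nlinarith
  have hmem : ∀ k, k ≤ N + 1 → a N k ∈ Set.uIcc 0 δ := by
    intro k hk
    have h1 : (k : ℝ) / (N + 1) ≤ 1 := by
      rw [div_le_one hN1]; exact_mod_cast hk
    have h0 : 0 ≤ (k : ℝ) / (N + 1) := by positivity
    rw [Set.mem_uIcc]
    simp only [ha]
    rcases le_total 0 δ with hδ | hδ
    · exact Or.inl ⟨by positivity, by nlinarith⟩
    · exact Or.inr ⟨by nlinarith, by nlinarith⟩
  have hcont : Continuous fun s : ℝ => Φ (s, x) := by fun_prop
  have hsum := intervalIntegral.sum_integral_adjacent_intervals (f := fun s => Φ (s, x))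
    (μ := MeasureTheory.volume) (a := a N) (n := N + 1)
    (fun k _ => hcont.intervalIntegrable _ _)
  have e0 : a N 0 = 0 := by simp [ha]
  have e1 : a N (N + 1) = δ := by simp only [ha]; push_cast; field_simp
  rw [e0, e1] at hsum
  rw [Real.dist_eq, hg, ← hsum]
  simp only [hSdef, ContinuousMap.coe_sum, Finset.sum_apply, ContinuousMap.coe_smul,
    Pi.smul_apply, ContinuousMap.curry_apply, smul_eq_mul]
  rw [← Finset.sum_sub_distrib]
  refine (Finset.abs_sum_le_sum_abs _ _).trans_lt ?_
  have hterm : ∀ k ∈ Finset.range (N + 1),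
      |(∫ s in a N k..a N (k + 1), Φ (s, x)) - δ / (N + 1) * Φ (a N k, x)|
        ≤ η * |δ / (N + 1)| := by
    intro k hk
    have hk' : k + 1 ≤ N + 1 := Finset.mem_range.mp hk
    rw [← hstep k, ← smul_eq_mul (a N (k + 1) - a N k), ← intervalIntegral.integral_const,
      ← intervalIntegral.integral_sub (hcont.intervalIntegrable _ _)
        (intervalIntegrable_const), ← Real.norm_eq_abs]
    refine intervalIntegral.norm_integral_le_of_norm_le_const fun s hs => ?_
    have hs' := Set.uIoc_subset_uIcc hs
    refine (H s ?_ _ (hmem k (by omega)) ?_ x hx).le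
    · exact Set.uIcc_subset_uIcc (hmem k (by omega)) (hmem (k + 1) hk') hs'
    · refine lt_of_le_of_lt ?_ hsmall
      rw [← hstep k]
      exact Set.abs_sub_left_of_mem_uIcc hs'
  refine (Finset.sum_le_sum hterm).trans_lt ?_
  rw [Finset.sum_const, Finset.card_range, nsmul_eq_mul, abs_div, abs_of_pos hN1]
  push_cast
  have : (N + 1 : ℝ) * (η * (|δ| / (N + 1))) = η * |δ| := by field_simp
  rwa [this]

theorem hasDerivAt_integral_add {g : ℝ → ℝ} (hg : Continuous g) (δ x : ℝ) :
    HasDerivAt (fun x => ∫ s in (0 : ℝ)..δ, g (x + s)) (g (x + δ) - g x) x := by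
  have e : (fun x => ∫ s in (0 : ℝ)..δ, g (x + s)) =
      fun x => (∫ s in (0 : ℝ)..x + δ, g s) - ∫ s in (0 : ℝ)..x, g s := by
    funext y
    rw [intervalIntegral.integral_comp_add_left, add_zero,
      intervalIntegral.integral_interval_sub_left (hg.intervalIntegrable _ _)
        (hg.intervalIntegrable _ _)]
  rw [e]
  exact ((hg.integral_hasStrictDerivAt 0 (x + δ)).hasDerivAt.comp_add_const x δ).sub
    (hg.integral_hasStrictDerivAt 0 x).hasDerivAt

/-- A continuous function all of whose second differences vanish is affine. -/
theorem exists_affine_of_second_difference_eq_zero {g : ℝ → ℝ} (hg : Continuous g)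
    (h : ∀ x δ, g (x + 2 * δ) - 2 * g (x + δ) + g x = 0) : ∃ a b : ℝ, ∀ x, g x = a * x + b := by
  let A : ℝ →+ ℝ :=
    { toFun := fun x => g x - g 0
      map_zero' := sub_self _
      map_add' := by
        intro x y
        have h1 := h x ((y - x) / 2)
        have h2 := h 0 ((x + y) / 2)
        rw [show x + 2 * ((y - x) / 2) = y by ring,
          show x + (y - x) / 2 = (x + y) / 2 by ring] at h1
        rw [show 0 + 2 * ((x + y) / 2) = x + y by ring, zero_add] at h2
        linarith }
  have hA : Continuous A := hg.sub continuous_const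
  refine ⟨A 1, g 0, fun x => ?_⟩
  have := map_real_smul A hA x 1
  simp only [smul_eq_mul, mul_one] at this
  have hx : A x = g x - g 0 := rfl
  linarith

theorem tendsto_second_difference_div_sq {ψ ψ' : ℝ → ℝ} {b θ : ℝ}
    (h1 : ∀ x, HasDerivAt ψ (ψ' x) x) (h2 : HasDerivAt ψ' θ b) :
    Tendsto (fun u => (ψ (b + u) - 2 * ψ b + ψ (b - u)) / u ^ 2) (𝓝[≠] 0) (𝓝 θ) := by
  have hd : ∀ u, HasDerivAt (fun u => ψ (b + u) - 2 * ψ b + ψ (b - u))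
      (ψ' (b + u) - ψ' (b - u)) u := by
    intro u
    have := (((h1 (b + u)).comp_const_add b u).sub_const (2 * ψ b)).add
      ((h1 (b - u)).comp_const_sub b u)
    exact this.congr_deriv (sub_eq_add_neg _ _).symm
  have hd2 : ∀ u : ℝ, HasDerivAt (fun u : ℝ => u ^ 2) (2 * u) u := by
    intro u; simpa using hasDerivAt_pow 2 u
  have hlim : ∀ F : ℝ → ℝ, Continuous F → F 0 = 0 → Tendsto F (𝓝[≠] 0) (𝓝 0) := by
    intro F hF h0
    have := hF.tendsto 0
    rw [h0] at this
    exact this.mono_left nhdsWithin_le_nhds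
  refine HasDerivAt.lhopital_zero_nhdsNE (Eventually.of_forall hd) (Eventually.of_forall hd2)
    ?_ ?_ ?_ ?_
  · filter_upwards [self_mem_nhdsWithin] with u hu
    exact mul_ne_zero two_ne_zero hu
  · refine hlim _ (continuous_iff_continuousAt.mpr fun u => (hd u).continuousAt) ?_
    simp; ring
  · exact hlim _ (by fun_prop) (by simp)
  · have t1 := hasDerivAt_iff_tendsto_slope_zero.mp h2
    have t2 : Tendsto (fun u : ℝ => -u) (𝓝[≠] 0) (𝓝[≠] 0) := by
      refine tendsto_nhdsWithin_iff.mpr ⟨hlim _ continuous_neg neg_zero, ?_⟩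
      filter_upwards [self_mem_nhdsWithin] with u hu
      simpa using hu
    have t3 := ((t1.add (t1.comp t2)).div_const 2)
    rw [add_self_div_two] at t3
    refine t3.congr' ?_
    filter_upwards [self_mem_nhdsWithin] with u hu
    have hu' : u ≠ 0 := hu
    simp only [Function.comp_apply, smul_eq_mul, ← sub_eq_add_neg]
    field_simp
    ring

/-- The closed linear span of the dilates and translates of a non-affine continuous function
contains the square function. -/
theorem sq_mem_of_comp_affine_mem {ρ : ℝ → ℝ} (hρ : Continuous ρ)
    (hna : ¬ ∃ a b : ℝ, ∀ x, ρ x = a * x + b) {V : Submodule ℝ C(ℝ, ℝ)}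
    (hV : IsClosed (V : Set C(ℝ, ℝ)))
    (h : ∀ (w b : ℝ) (g : C(ℝ, ℝ)), (∀ t, g t = ρ (w * t + b)) → g ∈ V)
    (q : C(ℝ, ℝ)) (hq : ∀ t, q t = t ^ 2) : q ∈ V := by
  obtain ⟨b, δ, hbδ⟩ : ∃ b δ, ρ (b + 2 * δ) - 2 * ρ (b + δ) + ρ b ≠ 0 := by
    by_contra! H
    exact hna (exists_affine_of_second_difference_eq_zero hρ H)
  set J : ℝ → ℝ := fun x => ∫ s in (0 : ℝ)..δ, ρ (x + s) with hJ
  have hJd : ∀ x, HasDerivAt J (ρ (x + δ) - ρ x) x := hasDerivAt_integral_add hρ δ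
  have hJc : Continuous J := continuous_iff_continuousAt.mpr fun x => (hJd x).continuousAt
  set ψ : ℝ → ℝ := fun x => ∫ s in (0 : ℝ)..δ, J (x + s) with hψ
  have hψd : ∀ x, HasDerivAt ψ (J (x + δ) - J x) x := hasDerivAt_integral_add hJc δ
  have hψc : Continuous ψ := continuous_iff_continuousAt.mpr fun x => (hψd x).continuousAt
  set θ := ρ (b + 2 * δ) - 2 * ρ (b + δ) + ρ b with hθ
  have hψ2 : HasDerivAt (fun x => J (x + δ) - J x) θ b := by
    refine (((hJd (b + δ)).comp_add_const b δ).sub (hJd b)).congr_deriv ?_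
    rw [hθ, show b + 2 * δ = b + δ + δ by ring]; ring
  have hJV : ∀ (w b : ℝ) (g : C(ℝ, ℝ)), (∀ t, g t = J (w * t + b)) → g ∈ V := by
    intro w b g hg
    exact mem_of_eq_intervalIntegral hV ⟨fun p => ρ (w * p.2 + b + p.1), by fun_prop⟩
      (fun s => h w (b + s) _ fun t => by simp [add_assoc]) δ g hg
  have hψV : ∀ (w b : ℝ) (g : C(ℝ, ℝ)), (∀ t, g t = ψ (w * t + b)) → g ∈ V := by
    intro w b g hg
    exact mem_of_eq_intervalIntegral hV ⟨fun p => J (w * p.2 + b + p.1), by fun_prop⟩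
      (fun s => hJV w (b + s) _ fun t => by simp [add_assoc]) δ g hg
  set κ : ℝ → ℝ := Function.update (fun u => (ψ (b + u) - 2 * ψ b + ψ (b - u)) / u ^ 2) 0 θ
    with hκ
  have hκ0 : κ 0 = θ := by simp [hκ]
  have hκne : ∀ u, u ≠ 0 → κ u = (ψ (b + u) - 2 * ψ b + ψ (b - u)) / u ^ 2 := by
    intro u hu; simp [hκ, hu]
  have hκc : Continuous κ := by
    rw [continuous_iff_continuousAt]
    intro u
    by_cases hu : u = 0
    · subst hu
      exact continuousAt_update_same.mpr (tendsto_second_difference_div_sq hψd hψ2)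
    · refine (continuousAt_update_of_ne hu).mpr ?_
      exact ContinuousAt.div (by fun_prop) (by fun_prop) (pow_ne_zero 2 hu)
  have key := curry_zero_mem_of_forall_ne hV ⟨fun p => p.2 ^ 2 * κ (p.1 * p.2), by fun_prop⟩ ?_
  · have : q = θ⁻¹ • ContinuousMap.curry
        (⟨fun p => p.2 ^ 2 * κ (p.1 * p.2), by fun_prop⟩ : C(ℝ × ℝ, ℝ)) 0 := by
      ext t
      simp [hq, hκ0]
      field_simp
    rw [this]
    exact V.smul_mem _ key
  · intro r hr
    have m1 := hψV r b ⟨fun t => ψ (r * t + b), by fun_prop⟩ fun t => rfl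
    have m2 := hψV 0 b ⟨fun t => ψ (0 * t + b), by fun_prop⟩ fun t => rfl
    have m3 := hψV (-r) b ⟨fun t => ψ (-r * t + b), by fun_prop⟩ fun t => rfl
    have m := V.smul_mem (r ^ 2)⁻¹ (V.add_mem (V.sub_mem m1 (V.smul_mem 2 m2)) m3)
    rw [SetLike.mem_coe]
    convert m using 1
    ext t
    simp only [ContinuousMap.curry_apply, ContinuousMap.coe_mk, ContinuousMap.coe_smul,
      ContinuousMap.coe_add, ContinuousMap.coe_sub, Pi.smul_apply, Pi.add_apply, Pi.sub_apply,
      smul_eq_mul]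
    by_cases ht : t = 0
    · subst ht; simp; ring_nf; simp
    · rw [hκne _ (mul_ne_zero hr ht), show -r * t + b = b - r * t by ring,
        show r * t + b = b + r * t by ring, zero_mul, zero_add]
      field_simp

end Squares

section Registers

open Function

/-- A closed set of self-maps of `ℝ^N`, stable under composition, in which any one coordinate may
be overwritten by an affine function of all coordinates, or by `ρ` of an affine function. -/
structure IsRegisterClosed (ρ : ℝ → ℝ) {N : ℕ} (S : Set C(Fin N → ℝ, Fin N → ℝ)) : Prop where
  isClosed : IsClosed S
  comp_mem : ∀ Ψ ∈ S, ∀ Φ ∈ S, Ψ.comp Φ ∈ S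
  affine_mem : ∀ (k : Fin N) (v : Fin N → ℝ) (b : ℝ) (Φ : C(Fin N → ℝ, Fin N → ℝ)),
    (∀ z, Φ z = update z k (v ⬝ᵥ z + b)) → Φ ∈ S
  act_mem : ∀ (k : Fin N) (v : Fin N → ℝ) (b : ℝ) (Φ : C(Fin N → ℝ, Fin N → ℝ)),
    (∀ z, Φ z = update z k (ρ (v ⬝ᵥ z + b))) → Φ ∈ S

/-- The map adding `G z` to the coordinate `k` and clearing the coordinate `s`. -/
def accumulate {N : ℕ} (k s : Fin N) (G : C(Fin N → ℝ, ℝ)) : C(Fin N → ℝ, Fin N → ℝ) where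
  toFun z := update (update z k (z k + G z)) s 0
  continuous_toFun := (continuous_id.update k (by fun_prop)).update s continuous_const

theorem continuous_accumulate {N : ℕ} (k s : Fin N) : Continuous (accumulate k s) := by
  refine ContinuousMap.continuous_of_continuous_uncurry _ ?_
  refine (continuous_snd.update k ?_).update s continuous_const
  have h1 : Continuous fun p : C(Fin N → ℝ, ℝ) × (Fin N → ℝ) => p.1 p.2 := by fun_prop
  have h2 : Continuous fun p : C(Fin N → ℝ, ℝ) × (Fin N → ℝ) => p.2 k := by fun_prop
  exact h2.add h1

theorem accumulate_zero_mem {ρ : ℝ → ℝ} {N : ℕ} {S : Set C(Fin N → ℝ, Fin N → ℝ)}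
    (h : IsRegisterClosed ρ S) (k s : Fin N) : accumulate k s 0 ∈ S :=
  h.affine_mem s 0 0 _ fun z => by simp [accumulate]

/-- The functions of the coordinates other than `k` and `s` that can be added to the coordinate
`k` using the scratch coordinate `s`. -/
def accumulable {ρ : ℝ → ℝ} {N : ℕ} {S : Set C(Fin N → ℝ, Fin N → ℝ)}
    (h : IsRegisterClosed ρ S) {k s : Fin N} (hks : k ≠ s) : Submodule ℝ C(Fin N → ℝ, ℝ) where
  carrier := {G | (∀ z a, G (update z k a) = G z) ∧ (∀ z a, G (update z s a) = G z) ∧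
    accumulate k s G ∈ S}
  zero_mem' := ⟨fun _ _ => rfl, fun _ _ => rfl, accumulate_zero_mem h k s⟩
  add_mem' := by
    rintro G G' ⟨h1, h2, h3⟩ ⟨h1', h2', h3'⟩
    refine ⟨fun z a => by simp [h1, h1'], fun z a => by simp [h2, h2'], ?_⟩
    convert h.comp_mem _ h3' _ h3 using 1
    ext z i
    simp only [accumulate, ContinuousMap.coe_mk, ContinuousMap.comp_apply, h1', h2']
    by_cases his : i = s
    · simp [his]
    · by_cases hik : i = k
      · simp [hik, hks, add_assoc]
      · simp [his, hik]
  smul_mem' := by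
    rintro a G ⟨h1, h2, h3⟩
    refine ⟨fun z a => by simp [h1], fun z a => by simp [h2], ?_⟩
    by_cases ha : a = 0
    · rw [ha, zero_smul]
      exact accumulate_zero_mem h k s
    · have hsc : ∀ r : ℝ, (⟨fun z => update z k (r * z k),
          continuous_id.update k (by fun_prop)⟩ : C(Fin N → ℝ, Fin N → ℝ)) ∈ S := fun r =>
        h.affine_mem k (Pi.single k r) 0 _ fun z => by simp
      convert h.comp_mem _ (h.comp_mem _ (hsc a) _ h3) _ (hsc a⁻¹) using 1
      ext z i
      simp only [accumulate, ContinuousMap.coe_mk, ContinuousMap.comp_apply, h1]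
      by_cases his : i = s
      · simp [his, hks.symm]
      · by_cases hik : i = k
        · simp [hik, hks, mul_add, ha]
        · simp [his, hik]

variable {ρ : ℝ → ℝ} {N : ℕ} {S : Set C(Fin N → ℝ, Fin N → ℝ)} (h : IsRegisterClosed ρ S)
  {k s : Fin N} (hks : k ≠ s)

theorem mem_accumulable {G : C(Fin N → ℝ, ℝ)} : G ∈ accumulable h hks ↔
    (∀ z a, G (update z k a) = G z) ∧ (∀ z a, G (update z s a) = G z) ∧ accumulate k s G ∈ S :=
  Iff.rfl

theorem isClosed_accumulable : IsClosed (accumulable h hks : Set C(Fin N → ℝ, ℝ)) := by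
  have hind : ∀ i : Fin N, IsClosed {G : C(Fin N → ℝ, ℝ) | ∀ z a, G (update z i a) = G z} := by
    intro i
    simp only [Set.ofPred_forall]
    refine isClosed_iInter fun z => isClosed_iInter fun a => isClosed_eq ?_ ?_ <;> fun_prop
  exact (hind k).inter ((hind s).inter (h.isClosed.preimage (continuous_accumulate k s)))

theorem dotProduct_update_of_eq_zero {v : Fin N → ℝ} {i : Fin N} (hv : v i = 0) (z : Fin N → ℝ)
    (a : ℝ) : v ⬝ᵥ update z i a = v ⬝ᵥ z := by
  refine Finset.sum_congr rfl fun j _ => ?_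
  by_cases hj : j = i
  · subst hj; simp [hv]
  · simp [hj]

theorem affine_mem_accumulable {v : Fin N → ℝ} (hvk : v k = 0) (hvs : v s = 0) (b : ℝ)
    (G : C(Fin N → ℝ, ℝ)) (hG : ∀ z, G z = v ⬝ᵥ z + b) : G ∈ accumulable h hks := by
  refine ⟨fun z a => by simp [hG, dotProduct_update_of_eq_zero hvk],
    fun z a => by simp [hG, dotProduct_update_of_eq_zero hvs], ?_⟩
  have m1 := h.affine_mem k (Pi.single k 1 + v) b
    ⟨fun z => update z k ((Pi.single k 1 + v) ⬝ᵥ z + b), continuous_id.update k (by fun_prop)⟩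
    fun z => rfl
  convert h.comp_mem _ (accumulate_zero_mem h k s) _ m1 using 1
  ext z i
  simp [accumulate, hG, add_dotProduct, add_assoc]

theorem act_mem_accumulable (hρ : Continuous ρ) {v : Fin N → ℝ} (hvk : v k = 0) (hvs : v s = 0)
    (b : ℝ) (G : C(Fin N → ℝ, ℝ)) (hG : ∀ z, G z = ρ (v ⬝ᵥ z + b)) :
    G ∈ accumulable h hks := by
  refine ⟨fun z a => by simp [hG, dotProduct_update_of_eq_zero hvk],
    fun z a => by simp [hG, dotProduct_update_of_eq_zero hvs], ?_⟩
  have m1 := h.act_mem s v b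
    ⟨fun z => update z s (ρ (v ⬝ᵥ z + b)), continuous_id.update s (by fun_prop)⟩ fun z => rfl
  have m2 := h.affine_mem k (Pi.single k 1 + Pi.single s 1) 0
    ⟨fun z => update z k ((Pi.single k 1 + Pi.single s 1) ⬝ᵥ z + 0),
      continuous_id.update k (by fun_prop)⟩ fun z => rfl
  convert h.comp_mem _ (accumulate_zero_mem h k s) _ (h.comp_mem _ m2 _ m1) using 1
  ext z i
  by_cases his : i = s
  · simp [accumulate, his]
  · by_cases hik : i = k
    · simp [accumulate, hik, hks, hG, add_dotProduct]
    · simp [accumulate, his, hik]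

theorem sq_apply_mem_accumulable (hρ : Continuous ρ)
    (hna : ¬ ∃ a b : ℝ, ∀ x, ρ x = a * x + b) {i : Fin N} (hik : i ≠ k) (his : i ≠ s)
    (G : C(Fin N → ℝ, ℝ)) (hG : ∀ z, G z = z i ^ 2) : G ∈ accumulable h hks := by
  let ev : C(Fin N → ℝ, ℝ) := ⟨fun z => z i, by fun_prop⟩
  let T : C(ℝ, ℝ) →ₗ[ℝ] C(Fin N → ℝ, ℝ) :=
    { toFun := fun g => g.comp ev, map_add' := fun _ _ => rfl, map_smul' := fun _ _ => rfl }
  have hT : Continuous T := ContinuousMap.continuous_precomp ev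
  have := sq_mem_of_comp_affine_mem hρ hna (V := (accumulable h hks).comap T)
    ((isClosed_accumulable h hks).preimage hT) (fun w b g hg =>
      act_mem_accumulable h hks hρ (v := Pi.single i w) (by simp [hik.symm]) (by simp [his.symm])
        b (T g) fun z => by simp [T, ev, hg]) ⟨fun t => t ^ 2, by fun_prop⟩ fun t => rfl
  convert (Submodule.mem_comap.mp this) using 1
  ext z
  simp [T, ev, hG]

/-- Squares of accumulable functions are accumulable, with an auxiliary coordinate `i` whose
content is restored at the end. -/
theorem mul_self_mem_accumulable (hρ : Continuous ρ)
    (hna : ¬ ∃ a b : ℝ, ∀ x, ρ x = a * x + b) {i : Fin N} (hik : i ≠ k) (his : i ≠ s)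
    {G : C(Fin N → ℝ, ℝ)} (hGi : G ∈ accumulable h his) (hGk : G ∈ accumulable h hks) :
    G * G ∈ accumulable h hks := by
  have hi := ((mem_accumulable h his).mp hGi).1
  obtain ⟨hk, hs, -⟩ := (mem_accumulable h hks).mp hGk
  let q : C(Fin N → ℝ, ℝ) := ⟨fun z => z i ^ 2, by fun_prop⟩
  have hq : q ∈ accumulable h hks :=
    sq_apply_mem_accumulable h hks hρ hna hik his q fun z => rfl
  have a1 := ((mem_accumulable h his).mp hGi).2.2
  have a2 := ((mem_accumulable h his).mp ((accumulable h his).smul_mem (-2) hGi)).2.2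
  have q1 := ((mem_accumulable h hks).mp hq).2.2
  have q2 := ((mem_accumulable h hks).mp ((accumulable h hks).smul_mem (-2) hq)).2.2
  have key : accumulate k s ((2 : ℝ) • (G * G)) ∈ S := by
    convert h.comp_mem _ q2 _ (h.comp_mem _ a1 _ (h.comp_mem _ q1 _ (h.comp_mem _ a2 _
      (h.comp_mem _ q1 _ a1)))) using 1
    ext z j
    by_cases hjs : j = s
    · simp [accumulate, hjs]
    · by_cases hjk : j = k
      · subst hjk
        simp [accumulate, hjs, hik, hik.symm, his, hi, hk, hs, q]
        ring
      · by_cases hji : j = i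
        · subst hji
          simp [accumulate, hjs, hjk, hi, hk, hs, q]
          ring
        · simp [accumulate, hjs, hjk, hji]
  have h2 : (2 : ℝ) • (G * G) ∈ accumulable h hks :=
    ⟨fun z a => by simp [hk], fun z a => by simp [hs], key⟩
  simpa [smul_smul] using (accumulable h hks).smul_mem (2⁻¹ : ℝ) h2

/-- A polynomial in the coordinates selected by `e`, as a function on `ℝ^N`. -/
noncomputable def polyMap {n : ℕ} (e : Fin n → Fin N) (P : MvPolynomial (Fin n) ℝ) :
    C(Fin N → ℝ, ℝ) where
  toFun z := MvPolynomial.eval (fun j => z (e j)) P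
  continuous_toFun := (MvPolynomial.continuous_eval P).comp (by fun_prop)

theorem polyMap_mem_accumulable (hρ : Continuous ρ)
    (hna : ¬ ∃ a b : ℝ, ∀ x, ρ x = a * x + b) {n : ℕ} {e : Fin n → Fin N}
    (hs : ∀ j, e j ≠ s)
    (hex : ∀ k, k ≠ s → (∀ j, e j ≠ k) → ∃ i, i ≠ k ∧ i ≠ s ∧ ∀ j, e j ≠ i)
    (P : MvPolynomial (Fin n) ℝ) :
    ∀ (k : Fin N) (hks : k ≠ s), (∀ j, e j ≠ k) → polyMap e P ∈ accumulable h hks := by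
  have hsq : ∀ G : C(Fin N → ℝ, ℝ),
      (∀ (k : Fin N) (hks : k ≠ s), (∀ j, e j ≠ k) → G ∈ accumulable h hks) →
      ∀ (k : Fin N) (hks : k ≠ s), (∀ j, e j ≠ k) → G * G ∈ accumulable h hks := by
    intro G hG k hks hk
    obtain ⟨i, hik, his, hi⟩ := hex k hks hk
    exact mul_self_mem_accumulable h hks hρ hna hik his (hG i his hi) (hG k hks hk)
  have hX : ∀ (j : Fin n) (k : Fin N) (hks : k ≠ s), (∀ j, e j ≠ k) →
      polyMap e (MvPolynomial.X j) ∈ accumulable h hks := by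
    intro j k hks hk
    exact affine_mem_accumulable h hks (v := Pi.single (e j) 1) (by simp [(hk j).symm])
      (by simp [(hs j).symm]) 0 _ fun z => by simp [polyMap]
  induction P using MvPolynomial.induction_on with
  | C a =>
    intro k hks hk
    exact affine_mem_accumulable h hks (v := 0) rfl rfl a _ fun z => by simp [polyMap]
  | add p q hp hq =>
    intro k hks hk
    convert (accumulable h hks).add_mem (hp k hks hk) (hq k hks hk) using 1
    ext z; simp [polyMap]
  | mul_X p j hp =>
    intro k hks hk
    have m1 := hsq _ (fun k hks hk => (accumulable h hks).add_mem (hp k hks hk) (hX j k hks hk))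
      k hks hk
    have m2 := hsq _ hp k hks hk
    have m3 := hsq _ (hX j) k hks hk
    convert (accumulable h hks).smul_mem (2⁻¹ : ℝ)
      ((accumulable h hks).sub_mem ((accumulable h hks).sub_mem m1 m2) m3) using 1
    ext z
    simp [polyMap]
    ring

/-- Several polynomials of the input coordinates can be written simultaneously into distinct
coordinates that are initially zero. -/
theorem exists_mem_eval_eq (h : IsRegisterClosed ρ S) (hρ : Continuous ρ)
    (hna : ¬ ∃ a b : ℝ, ∀ x, ρ x = a * x + b) {n m : ℕ} {e : Fin n → Fin N}
    {y : Fin m → Fin N} (hy : Injective y) (hys : ∀ j, y j ≠ s) (hey : ∀ i j, e i ≠ y j)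
    (hs : ∀ j, e j ≠ s)
    (hex : ∀ k, k ≠ s → (∀ j, e j ≠ k) → ∃ i, i ≠ k ∧ i ≠ s ∧ ∀ j, e j ≠ i)
    (P : Fin m → MvPolynomial (Fin n) ℝ) :
    ∃ F ∈ S, ∀ z : Fin N → ℝ, (∀ j, z (y j) = 0) → ∀ j,
      F z (y j) = MvPolynomial.eval (fun i => z (e i)) (P j) := by
  suffices H : ∀ t : Finset (Fin m), ∃ F ∈ S, ∀ z : Fin N → ℝ, (∀ j, z (y j) = 0) →
      (∀ i, F z (e i) = z (e i)) ∧ (∀ j ∈ t, F z (y j) =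
        MvPolynomial.eval (fun i => z (e i)) (P j)) ∧ ∀ j ∉ t, F z (y j) = 0 by
    obtain ⟨F, hF, hz⟩ := H Finset.univ
    exact ⟨F, hF, fun z h0 j => (hz z h0).2.1 j (Finset.mem_univ j)⟩
  intro t
  induction t using Finset.induction_on with
  | empty =>
    refine ⟨_, accumulate_zero_mem h s s, fun z h0 => ⟨fun i => ?_, by simp, fun j _ => ?_⟩⟩
    · simp [accumulate, hs]
    · simp [accumulate, hys, h0]
  | insert l t hl ih =>
    obtain ⟨F, hF, hz⟩ := ih
    have m := ((mem_accumulable h (hys l)).mp (polyMap_mem_accumulable h hρ hna hs hex (P l)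
      (y l) (hys l) fun j => hey j l)).2.2
    refine ⟨_, h.comp_mem _ m _ hF, fun z h0 => ?_⟩
    obtain ⟨z1, z2, z3⟩ := hz z h0
    refine ⟨fun i => ?_, fun j hj => ?_, fun j hj => ?_⟩
    · simp [accumulate, hs, hey, z1]
    · by_cases hjl : j = l
      · subst hjl
        simp [accumulate, hys, z3 j hl, polyMap, z1]
      · have hjt : j ∈ t := (Finset.mem_insert.mp hj).resolve_left hjl
        simp [accumulate, hys, hy.ne hjl, z2 j hjt]
    · rw [Finset.mem_insert, not_or] at hj
      simp [accumulate, hys, hy.ne hj.1, z3 j hj.2]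

end Registers

section Networks

open Function

theorem dlorForward_append (ρ : ℝ → ℝ) {N : ℕ}
    (L L' : List (ℝ × (Fin N → ℝ) × (Fin N → ℝ) × (Fin N → ℝ))) (z : Fin N → ℝ) :
    dlorForward ρ (L ++ L') z = dlorForward ρ L' (dlorForward ρ L z) :=
  List.foldl_append

theorem dlorForward_singleton_apply (ρ : ℝ → ℝ) {N : ℕ} (α : ℝ) (u v b z : Fin N → ℝ)
    (i : Fin N) :
    dlorForward ρ [(α, u, v, b)] z i = ρ (α * z i + u i * (v ⬝ᵥ z) + b i) := by
  simp [dlorForward, Matrix.add_mulVec, Matrix.smul_mulVec, Matrix.vecMulVec_mulVec, mul_comm]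

/-- Scaling and shifting the input of a layer gives another layer. -/
theorem exists_dlorForward_singleton_eq (ρ : ℝ → ℝ) {N : ℕ}
    (p : ℝ × (Fin N → ℝ) × (Fin N → ℝ) × (Fin N → ℝ)) (a : ℝ) (d : Fin N → ℝ) :
    ∃ q, ∀ w, dlorForward ρ [p] (a • w + d) = dlorForward ρ [q] w := by
  obtain ⟨α, u, v, b⟩ := p
  refine ⟨(α * a, u, a • v, α • d + (v ⬝ᵥ d) • u + b), fun w => ?_⟩
  ext i
  rw [dlorForward_singleton_apply, dlorForward_singleton_apply]
  congr 1
  simp [dotProduct_add]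
  ring

/-- The continuous maps computed by a DLoR network followed by a scaling and a shift. -/
def shiftedNets (ρ : ℝ → ℝ) (N : ℕ) : Set C(Fin N → ℝ, Fin N → ℝ) :=
  {Φ | ∃ (L : List (ℝ × (Fin N → ℝ) × (Fin N → ℝ) × (Fin N → ℝ))) (a : ℝ) (d : Fin N → ℝ),
    ∀ z, Φ z = a • dlorForward ρ L z + d}

theorem comp_mem_shiftedNets {ρ : ℝ → ℝ} {N : ℕ} {Ψ Φ : C(Fin N → ℝ, Fin N → ℝ)}
    (hΨ : Ψ ∈ shiftedNets ρ N) (hΦ : Φ ∈ shiftedNets ρ N) : Ψ.comp Φ ∈ shiftedNets ρ N := by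
  obtain ⟨L, a, d, hL⟩ := hΦ
  obtain ⟨L', a', d', hL'⟩ := hΨ
  cases L' with
  | nil =>
    refine ⟨L, a' * a, a' • d + d', fun z => ?_⟩
    simp [hL, hL', dlorForward, smul_smul, add_assoc]
  | cons p ps =>
    obtain ⟨q, hq⟩ := exists_dlorForward_singleton_eq ρ p a d
    refine ⟨L ++ ([q] ++ ps), a', d', fun z => ?_⟩
    rw [dlorForward_append, dlorForward_append, ← hq, ← hL, ← dlorForward_append]
    simp [hL']

theorem comp_mem_closure_shiftedNets {ρ : ℝ → ℝ} {N : ℕ} {Ψ Φ : C(Fin N → ℝ, Fin N → ℝ)}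
    (hΨ : Ψ ∈ closure (shiftedNets ρ N)) (hΦ : Φ ∈ closure (shiftedNets ρ N)) :
    Ψ.comp Φ ∈ closure (shiftedNets ρ N) :=
  map_mem_closure₂ (f := fun Φ Ψ : C(Fin N → ℝ, Fin N → ℝ) => Ψ.comp Φ)
    ContinuousMap.continuous_comp' hΦ hΨ fun _ ha _ hb => comp_mem_shiftedNets hb ha

/-- The rescaled increment `(ρ (c + r t) - ρ c) / (r ρ'(c))`, extended by `t` at `r = 0`. -/
noncomputable def rescaledIncrement (ρ : ℝ → ℝ) (c r t : ℝ) : ℝ :=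
  dslope ρ c (c + r * t) * t / deriv ρ c

theorem continuous_rescaledIncrement {ρ : ℝ → ℝ} (hρ : Continuous ρ) {c : ℝ}
    (hdiff : DifferentiableAt ℝ ρ c) :
    Continuous fun p : ℝ × ℝ => rescaledIncrement ρ c p.1 p.2 := by
  have : Continuous (dslope ρ c) := by
    rw [← continuousOn_univ, continuousOn_dslope Filter.univ_mem]
    exact ⟨hρ.continuousOn, hdiff⟩
  unfold rescaledIncrement
  fun_prop

theorem rescaledIncrement_zero {ρ : ℝ → ℝ} {c : ℝ} (hd : deriv ρ c ≠ 0) (t : ℝ) :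
    rescaledIncrement ρ c 0 t = t := by
  simp [rescaledIncrement, hd]

theorem rescaledIncrement_of_ne {ρ : ℝ → ℝ} {c r : ℝ} (hr : r ≠ 0) (t : ℝ) :
    rescaledIncrement ρ c r t = (r * deriv ρ c)⁻¹ * (ρ (r * t + c) - ρ c) := by
  have := sub_smul_dslope ρ c (c + r * t)
  rw [add_sub_cancel_left, smul_eq_mul] at this
  rw [add_comm (r * t) c, ← this, rescaledIncrement, mul_inv, div_eq_mul_inv]
  field_simp

theorem dlor_affine_mem_closure_shiftedNets {ρ : ℝ → ℝ} (hρ : Continuous ρ) {c : ℝ}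
    (hdiff : DifferentiableAt ℝ ρ c) (hd : deriv ρ c ≠ 0) {N : ℕ} (α : ℝ) (u v b : Fin N → ℝ)
    (Φ : C(Fin N → ℝ, Fin N → ℝ)) (hΦ : ∀ z i, Φ z i = α * z i + u i * (v ⬝ᵥ z) + b i) :
    Φ ∈ closure (shiftedNets ρ N) := by
  have hσ := continuous_rescaledIncrement hρ hdiff
  let Γ : C(ℝ × (Fin N → ℝ), Fin N → ℝ) :=
    ⟨fun p i => rescaledIncrement ρ c p.1 (Φ p.2 i), by
      refine continuous_pi fun i => hσ.comp (continuous_fst.prodMk ?_)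
      fun_prop⟩
  have e : Φ = Γ.curry 0 := by
    ext z i; simp [Γ, rescaledIncrement_zero hd]
  rw [e]
  refine curry_zero_mem_of_forall_ne isClosed_closure Γ fun r hr => subset_closure ?_
  refine ⟨[(r * α, r • u, v, fun i => r * b i + c)], (r * deriv ρ c)⁻¹,
    fun _ => -((r * deriv ρ c)⁻¹ * ρ c), fun z => ?_⟩
  ext i
  have : r * Φ z i + c = r * α * z i + (r • u) i * (v ⬝ᵥ z) + (r * b i + c) := by
    rw [hΦ]; simp; ring
  rw [Pi.add_apply, Pi.smul_apply, dlorForward_singleton_apply, ← this]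
  simp [Γ, rescaledIncrement_of_ne hr]
  ring

theorem update_act_mem_closure_shiftedNets {ρ : ℝ → ℝ} (hρ : Continuous ρ) {c : ℝ}
    (hdiff : DifferentiableAt ℝ ρ c) (hd : deriv ρ c ≠ 0) {N : ℕ} (k : Fin N) (v : Fin N → ℝ)
    (b : ℝ) (Φ : C(Fin N → ℝ, Fin N → ℝ)) (hΦ : ∀ z, Φ z = update z k (ρ (v ⬝ᵥ z + b))) :
    Φ ∈ closure (shiftedNets ρ N) := by
  have hσ := continuous_rescaledIncrement hρ hdiff
  let Γ : C(ℝ × (Fin N → ℝ), Fin N → ℝ) :=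
    ⟨fun p => update (fun i => rescaledIncrement ρ c p.1 (p.2 i)) k (ρ (v ⬝ᵥ p.2 + b)), by
      refine Continuous.update ?_ k (by fun_prop)
      exact continuous_pi fun i => hσ.comp (continuous_fst.prodMk (by fun_prop))⟩
  have e : Φ = Γ.curry 0 := by
    ext z i; simp [Γ, rescaledIncrement_zero hd, hΦ]
  rw [e]
  refine curry_zero_mem_of_forall_ne isClosed_closure Γ fun r hr => ?_
  -- a layer applying `ρ` as required at `k` and nearly linearly elsewhere, then a rescaling
  let layer : C(Fin N → ℝ, Fin N → ℝ) :=
    ⟨fun z => update (fun i => ρ (r * z i + c)) k (ρ (v ⬝ᵥ z + b)),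
      Continuous.update (by fun_prop) k (by fun_prop)⟩
  have h1 : layer ∈ closure (shiftedNets ρ N) := by
    refine subset_closure ⟨[(r, Pi.single k 1, v - Pi.single k r, update (fun _ => c) k b)], 1, 0,
      fun z => ?_⟩
    ext i
    rw [one_smul, add_zero, dlorForward_singleton_apply]
    by_cases hi : i = k
    · subst hi; simp [layer, sub_dotProduct]
    · simp [layer, hi]
  set α := (r * deriv ρ c)⁻¹ with hα
  let T : C(Fin N → ℝ, Fin N → ℝ) :=
    ⟨fun z => update (fun i => α * (z i - ρ c)) k (z k),
      Continuous.update (by fun_prop) k (by fun_prop)⟩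
  have h2 : T ∈ closure (shiftedNets ρ N) := by
    refine dlor_affine_mem_closure_shiftedNets hρ hdiff hd α (Pi.single k 1)
      (Pi.single k (1 - α)) (update (fun _ => -(α * ρ c)) k 0) T fun z i => ?_
    by_cases hi : i = k
    · subst hi; simp [T]; ring
    · simp [T, hi]; ring
  convert comp_mem_closure_shiftedNets h2 h1 using 1
  ext z i
  by_cases hi : i = k
  · subst hi; simp [Γ, T, layer]
  · simp [Γ, T, layer, hi, rescaledIncrement_of_ne hr, hα]

theorem isRegisterClosed_closure_shiftedNets {ρ : ℝ → ℝ} (hρ : Continuous ρ) {c : ℝ}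
    (hdiff : DifferentiableAt ℝ ρ c) (hd : deriv ρ c ≠ 0) (N : ℕ) :
    IsRegisterClosed ρ (closure (shiftedNets ρ N)) where
  isClosed := isClosed_closure
  comp_mem _ hΨ _ hΦ := comp_mem_closure_shiftedNets hΨ hΦ
  affine_mem k v b Φ hΦ := by
    refine dlor_affine_mem_closure_shiftedNets hρ hdiff hd 1 (Pi.single k 1)
      (v - Pi.single k 1) (Pi.single k b) Φ fun z i => ?_
    by_cases hi : i = k
    · subst hi; simp [hΦ, sub_dotProduct]
    · simp [hΦ, hi]
  act_mem := update_act_mem_closure_shiftedNets hρ hdiff hd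

/-- Chosen coordinates of a limit of networks are a limit of linear readouts of nonempty
networks: the shift is absorbed by a coordinate `s` that the last layer makes constant. -/
theorem coordinates_mem_closure_readouts {ρ : ℝ → ℝ} (hρ : Continuous ρ) {c : ℝ}
    (hdiff : DifferentiableAt ℝ ρ c) (hd : deriv ρ c ≠ 0) {t₀ : ℝ} (ht₀ : ρ t₀ ≠ 0) {N m : ℕ}
    {X : Type*} [TopologicalSpace X] (pad : C(X, Fin N → ℝ)) {y : Fin m → Fin N} {s : Fin N}
    (hys : ∀ j, y j ≠ s) {F : C(Fin N → ℝ, Fin N → ℝ)} (hF : F ∈ closure (shiftedNets ρ N))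
    (g : C(X, Fin m → ℝ)) (hg : ∀ x j, g x j = F (pad x) (y j)) :
    g ∈ closure {G : C(X, Fin m → ℝ) | ∃ L, L ≠ [] ∧ ∃ C : Matrix (Fin m) (Fin N) ℝ,
      ∀ x, G x = C.mulVec (dlorForward ρ L (pad x))} := by
  have hσ := continuous_rescaledIncrement hρ hdiff
  let Γ : ℝ → C(Fin N → ℝ, Fin N → ℝ) → C(X, Fin m → ℝ) := fun r Φ =>
    ⟨fun x j => rescaledIncrement ρ c r (Φ (pad x) (y j)), by
      refine continuous_pi fun j => hσ.comp (continuous_const.prodMk ?_)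
      fun_prop⟩
  have hΓ : Continuous (uncurry Γ) := by
    refine ContinuousMap.continuous_of_continuous_uncurry _ ?_
    refine continuous_pi fun j => hσ.comp ((continuous_fst.comp continuous_fst).prodMk ?_)
    refine (continuous_apply (y j)).comp ?_
    have h1 : Continuous fun p : (ℝ × C(Fin N → ℝ, Fin N → ℝ)) × X => p.1.2 := by fun_prop
    have h2 : Continuous fun p : (ℝ × C(Fin N → ℝ, Fin N → ℝ)) × X => pad p.2 := by fun_prop
    exact h1.eval h2
  have e : g = Γ 0 F := by
    ext x j; simp [Γ, rescaledIncrement_zero hd, hg]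
  rw [e]
  refine map_mem_closure₂ hΓ (s := {0}ᶜ) (dense_compl_singleton (0 : ℝ) 0) hF fun r hr Φ hΦ => ?_
  obtain ⟨L, a, d, hL⟩ := hΦ
  obtain ⟨q, hq⟩ := exists_dlorForward_singleton_eq ρ
    (r, Pi.single s 1, Pi.single s (-r), update (fun _ => c) s t₀) a d
  refine ⟨L ++ [q], by simp, fun j => Pi.single (y j) (r * deriv ρ c)⁻¹ -
    Pi.single s ((r * deriv ρ c)⁻¹ * ρ c / ρ t₀), fun x => ?_⟩
  rw [dlorForward_append, ← hq, ← hL]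
  ext j
  have hr' : r ≠ 0 := hr
  simp only [Γ, Matrix.mulVec, sub_dotProduct, single_dotProduct, dlorForward_singleton_apply,
    ContinuousMap.coe_mk, rescaledIncrement_of_ne hr']
  simp [hys]
  field_simp

end Networks

/-- Polynomials are uniformly dense among the continuous functions on a compact subset of
`ℝ^n`. -/
theorem exists_mvPolynomial_near {n : ℕ} {K : Set (Fin n → ℝ)} (hK : IsCompact K) (f : C(K, ℝ))
    {ε : ℝ} (hε : 0 < ε) :
    ∃ P : MvPolynomial (Fin n) ℝ, ∀ x : K, |MvPolynomial.eval (x : Fin n → ℝ) P - f x| < ε := by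
  have : CompactSpace K := isCompact_iff_compactSpace.mp hK
  let X : Fin n → C(K, ℝ) := fun j =>
    ⟨fun x => (x : Fin n → ℝ) j, (continuous_apply j).comp continuous_subtype_val⟩
  have hev : ∀ (P : MvPolynomial (Fin n) ℝ) (x : K),
      MvPolynomial.aeval X P x = MvPolynomial.eval (x : Fin n → ℝ) P := by
    intro P x
    induction P using MvPolynomial.induction_on with
    | C a => simp [Algebra.algebraMap_eq_smul_one]
    | add p q hp hq => simp [hp, hq]
    | mul_X p j hp => simp [hp, X]
  have hsep : (MvPolynomial.aeval X : MvPolynomial (Fin n) ℝ →ₐ[ℝ] C(K, ℝ)).range.SeparatesPoints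
      := by
    intro x x' hxx
    obtain ⟨j, hj⟩ : ∃ j, (x : Fin n → ℝ) j ≠ (x' : Fin n → ℝ) j := by
      by_contra! H
      exact hxx (Subtype.ext (funext H))
    exact ⟨_, ⟨X j, ⟨MvPolynomial.X j, by simp⟩, rfl⟩, hj⟩
  obtain ⟨⟨_, P, rfl⟩, hP⟩ :=
    ContinuousMap.exists_mem_subalgebra_near_continuousMap_of_separatesPoints _ hsep f ε hε
  refine ⟨P, fun x => ?_⟩
  rw [← hev]
  exact (ContinuousMap.norm_coe_le_norm (_ - f) x).trans_lt hP

/-- Deep DLoR universal approximation, width `n + m + 2`: for any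
non-affine continuous `ρ` differentiable at some `c` with `ρ'(c) ≠ 0`, any compact
`K ⊆ ℝ^n`, any continuous `f : K → ℝ^m`, and any `ε > 0`, there is a deep network
with every hidden weight matrix of the DLoR form `α I + u vᵀ`, width `n + m + 2`,
zero-padded input and linear readout, that approximates `f` uniformly within `ε`. -/
theorem stmt12 (ρ : ℝ → ℝ) (hρc : Continuous ρ)
    (hna : ¬ ∃ a b : ℝ, ∀ x, ρ x = a * x + b)
    (c : ℝ) (hdiff : DifferentiableAt ℝ ρ c) (hd : deriv ρ c ≠ 0)
    (n m : ℕ) (K : Set (Fin n → ℝ)) (hK : IsCompact K)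
    (f : (Fin n → ℝ) → Fin m → ℝ) (hf : ContinuousOn f K)
    (ε : ℝ) (hε : 0 < ε) :
    ∃ layers : List (ℝ × (Fin (n + m + 2) → ℝ) × (Fin (n + m + 2) → ℝ) ×
        (Fin (n + m + 2) → ℝ)),
      layers ≠ [] ∧
      ∃ C : Matrix (Fin m) (Fin (n + m + 2)) ℝ,
        ∀ x ∈ K, ‖C.mulVec (dlorForward ρ layers (padInput n (n + m + 2) x)) - f x‖ < ε := by
  obtain ⟨t₀, ht₀⟩ : ∃ t, ρ t ≠ 0 := by
    by_contra! H
    exact hna ⟨0, 0, fun x => by simp [H]⟩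
  have : CompactSpace K := isCompact_iff_compactSpace.mp hK
  rcases Nat.eq_zero_or_pos m with rfl | hm
  · refine ⟨[(0, 0, 0, 0)], by simp, 0, fun x _ => ?_⟩
    rwa [Subsingleton.elim (_ - f x) 0, norm_zero]
  let N := n + m + 2
  let e : Fin n → Fin N := fun j => ⟨j, by omega⟩
  let y : Fin m → Fin N := fun j => ⟨n + j, by omega⟩
  let s : Fin N := ⟨n + m, by omega⟩
  have hy : Function.Injective y := fun i j hij => by
    have := congrArg Fin.val hij
    exact Fin.ext (by simpa [y] using this)
  have hys : ∀ j, y j ≠ s := fun j hj => by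
    have : n + (j : ℕ) = n + m := congrArg Fin.val hj
    omega
  have hey : ∀ i j, e i ≠ y j := fun i j hj => by
    have : (i : ℕ) = n + j := congrArg Fin.val hj
    omega
  have hs : ∀ j, e j ≠ s := fun j hj => by
    have : (j : ℕ) = n + m := congrArg Fin.val hj
    omega
  have hex : ∀ k, k ≠ s → (∀ j, e j ≠ k) → ∃ i, i ≠ k ∧ i ≠ s ∧ ∀ j, e j ≠ i := by
    intro k _ _
    by_cases hk : k = y ⟨0, hm⟩
    · refine ⟨⟨n + m + 1, by omega⟩, ?_, ?_, fun j => ?_⟩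
      · rw [hk]; intro H
        have : n + m + 1 = n + 0 := congrArg Fin.val H
        omega
      · intro H
        have : n + m + 1 = n + m := congrArg Fin.val H
        omega
      · intro H
        have : (j : ℕ) = n + m + 1 := congrArg Fin.val H
        omega
    · exact ⟨y ⟨0, hm⟩, fun H => hk H.symm, hys _, fun j => hey _ _⟩
  let fK : C(K, Fin m → ℝ) := ⟨K.domRestrict f, hf.domRestrict⟩
  choose P hP using fun j => exists_mvPolynomial_near hK
    (⟨fun x => fK x j, by fun_prop⟩ : C(K, ℝ)) (half_pos hε)
  obtain ⟨F, hF, hFz⟩ := exists_mem_eval_eq (isRegisterClosed_closure_shiftedNets hρc hdiff hd N)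
    hρc hna hy hys hey hs hex P
  let pad : C(K, Fin N → ℝ) := ⟨fun x => padInput n N x, by
    refine continuous_pi fun i => ?_
    unfold padInput
    split_ifs
    · exact (continuous_apply _).comp continuous_subtype_val
    · exact continuous_const⟩
  have hpad : ∀ (x : K) j, F (pad x) (y j) = MvPolynomial.eval (x : Fin n → ℝ) (P j) := by
    intro x j
    rw [hFz _ (fun j => by simp [pad, padInput, y])]
    congr 2
    funext i
    simp [pad, padInput, e]
  let g : C(K, Fin m → ℝ) := ⟨fun x j => F (pad x) (y j), by fun_prop⟩
  have hg := coordinates_mem_closure_readouts hρc hdiff hd ht₀ pad hys hF g fun _ _ => rfl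
  obtain ⟨G, ⟨L, hL, C, hG⟩, hgG⟩ := Metric.mem_closure_iff.mp hg (ε / 2) (half_pos hε)
  refine ⟨L, hL, C, fun x hx => ?_⟩
  have h1 : ‖G ⟨x, hx⟩ - g ⟨x, hx⟩‖ < ε / 2 := by
    rw [← dist_eq_norm, dist_comm]
    exact (ContinuousMap.dist_apply_le_dist _).trans_lt hgG
  have h2 : ‖g ⟨x, hx⟩ - f x‖ < ε / 2 := by
    rw [pi_norm_lt_iff (half_pos hε)]
    intro j
    have := hP j ⟨x, hx⟩
    rw [← hpad] at this
    exact this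
  rw [hG] at h1
  calc _ = ‖(C.mulVec (dlorForward ρ L (pad ⟨x, hx⟩)) - g ⟨x, hx⟩) + (g ⟨x, hx⟩ - f x)‖ := by
        rw [sub_add_sub_cancel]; rfl
    _ < ε := (norm_add_le _ _).trans_lt (by linarith)
end

section
/- Let ρ : ℝ → ℝ be a non-affine continuous function that is differentiable at some point c ∈ ℝ with ρ'(c) ≠ 0, applied componentwise. Let K ⊂ ℝ^n be compact, f : K → ℝ^m continuous, and ε > 0. Then there exists a network built entirely from parallel (additive) DLoR ensembles that approximates f uniformly within ε: there exist a depth D, widths, and for each layer j an ensemble size L_j, rank-1 matrices A_{j,1}, ..., A_{j,L_j}, scalars c_{j,1}, ..., c_{j,L_j}, vectors d_{j,1}, ..., d_{j,L_j}, and a bias b_j, such that each layer computes z ↦ ρ( ∑_{l=1}^{L_j} c_{j,l} ρ(A_{j,l} z + d_{j,l}) + b_j ), and the composed network f̂ (with zero-padded input and linear readout) satisfies sup_{x ∈ K} ‖f̂(x) − f(x)‖ < ε. That is, wide networks whose dense affine layers are replaced by parallel summations of low-rank components are dense in C(K, ℝ^m) with respect to the uniform norm. -/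
/-- One parallel (additive) DLoR ensemble layer: it replaces a dense affine layer by
`z ↦ ρ(∑ l, c l • ρ(A l z + d l) + b)`, computed componentwise, where the `A l` are
(low-rank) matrices. -/
noncomputable def wideLayer {nin nout : ℕ} (ρ : ℝ → ℝ) (L : ℕ)
    (A : Fin L → Matrix (Fin nout) (Fin nin) ℝ) (coef : Fin L → ℝ)
    (d : Fin L → Fin nout → ℝ) (b : Fin nout → ℝ) (z : Fin nin → ℝ) : Fin nout → ℝ :=
  fun i => ρ ((∑ l, coef l * ρ ((A l).mulVec z i + d l i)) + b i)

theorem ContinuousMap.mem_closure_iff_forall_isCompact {X : Type*} [TopologicalSpace X]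
    {S : Set C(X, ℝ)} {g : C(X, ℝ)} :
    g ∈ closure S ↔ ∀ B : Set X, IsCompact B → ∀ ε > 0, ∃ s ∈ S, ∀ x ∈ B, |s x - g x| < ε := by
  rw [mem_closure_iff_nhds_basis
    (nhds_basis_uniformity Metric.uniformity_basis_dist.compactConvergenceUniformity)]
  simp only [Set.mem_ofPred_eq, Prod.forall, and_imp, Real.dist_eq]
  exact ⟨fun h B hB ε hε => h B ε hB hε, fun h B ε hB hε => h B hB ε hε⟩

/-- If a convergent expansion `e u = α u ^ p + o(u ^ p)` holds at `0`, then the rescalings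
`α⁻¹ s⁻ᵖ e (s u)` approximate `u ^ p` uniformly on bounded sets. -/
theorem exists_rescale_near_pow {e : ℝ → ℝ} {p : ℕ} {α : ℝ} (hα : α ≠ 0)
    (he : (fun u => e u - α * u ^ p) =o[nhds 0] fun u : ℝ => u ^ p) (R : ℝ) {ε : ℝ} (hε : 0 < ε) :
    ∃ s : ℝ, 0 < s ∧ ∀ u : ℝ, |u| ≤ R → |(α * s ^ p)⁻¹ * e (s * u) - u ^ p| < ε := by
  have hα' : 0 < |α| := abs_pos.2 hα
  set M : ℝ := (|R| + 1) ^ p with hM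
  have hM0 : 0 < M := by positivity
  have hη : 0 < ε * |α| / (2 * M) := by positivity
  obtain ⟨δ, hδ, hball⟩ := Metric.eventually_nhds_iff.1 (he.def hη)
  set s : ℝ := δ / (2 * (|R| + 1)) with hs
  have hR : 0 < |R| + 1 := by positivity
  have hs0 : 0 < s := by positivity
  refine ⟨s, hs0, fun u hu => ?_⟩
  have hu' : |u| ≤ |R| + 1 := by linarith [le_abs_self R]
  have hsu : dist (s * u) 0 < δ := by
    rw [Real.dist_eq, sub_zero, abs_mul, abs_of_pos hs0]
    calc s * |u| ≤ s * (|R| + 1) := by gcongr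
      _ = δ / 2 := by rw [hs]; field_simp
      _ < δ := by linarith
  have h := hball hsu
  rw [Real.norm_eq_abs, Real.norm_eq_abs] at h
  have hsp : 0 < s ^ p := by positivity
  have key : (α * s ^ p)⁻¹ * e (s * u) - u ^ p
      = (α * s ^ p)⁻¹ * (e (s * u) - α * (s * u) ^ p) := by
    rw [mul_pow]
    field_simp
  have hup : |u| ^ p ≤ M := by rw [hM]; gcongr
  rw [key, abs_mul, abs_inv, abs_mul, abs_of_pos hsp]
  calc (|α| * s ^ p)⁻¹ * |e (s * u) - α * (s * u) ^ p|
      ≤ (|α| * s ^ p)⁻¹ * (ε * |α| / (2 * M) * |(s * u) ^ p|) := by gcongr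
    _ = ε / 2 * (|u| ^ p / M) := by
      rw [abs_pow, abs_mul, abs_of_pos hs0, mul_pow]; field_simp
    _ ≤ ε / 2 * 1 := by gcongr; rwa [div_le_one hM0]
    _ < ε := by linarith

/-- The affine function `x ↦ a x + b` as a continuous map. -/
def affineCM (a b : ℝ) : C(ℝ, ℝ) := ⟨fun x => a * x + b, by fun_prop⟩

@[simp] theorem affineCM_apply (a b x : ℝ) : affineCM a b x = a * x + b := rfl

/-- The sliding average `x ↦ ∫ t in 0..1, g (x + h t)`. -/
noncomputable def slidingAverage (h : ℝ) (g : C(ℝ, ℝ)) : C(ℝ, ℝ) :=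
  ⟨fun x => ∫ t in (0 : ℝ)..1, g (x + h * t), by
    apply intervalIntegral.continuous_parametric_intervalIntegral_of_continuous'
    fun_prop⟩

theorem slidingAverage_apply (h : ℝ) (g : C(ℝ, ℝ)) (x : ℝ) :
    slidingAverage h g x = ∫ t in (0 : ℝ)..1, g (x + h * t) := rfl

theorem hasDerivAt_slidingAverage {h : ℝ} (hh : h ≠ 0) (g : C(ℝ, ℝ)) (x : ℝ) :
    HasDerivAt (slidingAverage h g) (h⁻¹ * (g (x + h) - g x)) x := by
  have hP (y : ℝ) : HasDerivAt (fun u => ∫ t in (0 : ℝ)..u, g t) (g y) y :=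
    (g.continuous.integral_hasStrictDerivAt 0 y).hasDerivAt
  have heq : (slidingAverage h g : ℝ → ℝ) = fun y =>
      h⁻¹ * ((∫ t in (0 : ℝ)..(y + h), g t) - ∫ t in (0 : ℝ)..y, g t) := by
    funext y
    rw [slidingAverage_apply, intervalIntegral.integral_comp_add_mul _ hh,
      intervalIntegral.integral_interval_sub_left (g.continuous.intervalIntegrable _ _)
        (g.continuous.intervalIntegrable _ _)]
    simp
  rw [heq]
  exact (((hP (x + h)).comp_add_const x h).sub (hP x)).const_mul h⁻¹

theorem slidingAverage_mem {V : Submodule ℝ C(ℝ, ℝ)} (hcl : IsClosed (V : Set C(ℝ, ℝ)))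
    (hV : ∀ a b, ∀ g ∈ V, g.comp (affineCM a b) ∈ V) {g : C(ℝ, ℝ)} (hg : g ∈ V) (h : ℝ) :
    slidingAverage h g ∈ V := by
  rw [← SetLike.mem_coe, ← hcl.closure_eq, ContinuousMap.mem_closure_iff_forall_isCompact]
  intro B hB ε hε
  have : CompactSpace B := isCompact_iff_compactSpace.1 hB
  let r : C(ℝ, ℝ) →L[ℝ] C(B, ℝ) := ContinuousMap.compCLM ℝ ℝ ⟨Subtype.val, continuous_subtype_val⟩
  let Φ : C(ℝ, C(B, ℝ)) :=
    ContinuousMap.curry ⟨fun q : ℝ × B => g ((q.2 : ℝ) + h * q.1), by fun_prop⟩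
  let μ : MeasureTheory.Measure ℝ := MeasureTheory.volume.restrict (Set.Ioc 0 1)
  have : MeasureTheory.IsProbabilityMeasure μ := ⟨by simp [μ]⟩
  have hint : MeasureTheory.Integrable Φ μ :=
    (Φ.continuous.integrableOn_Icc (a := 0) (b := 1)).mono_set Set.Ioc_subset_Icc_self
  have hmem : ∫ t, Φ t ∂μ ∈ ((V.map r.toLinearMap).topologicalClosure : Set C(B, ℝ)) := by
    refine Convex.integral_mem (Submodule.convex _) (Submodule.isClosed_topologicalClosure _)
      (Filter.Eventually.of_forall fun t => ?_) hint
    refine Submodule.le_topologicalClosure _ ⟨_, hV 1 (h * t) g hg, ?_⟩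
    ext x
    simp [r, Φ]
  rw [Submodule.topologicalClosure_coe, Metric.mem_closure_iff] at hmem
  obtain ⟨_, ⟨s, hs, rfl⟩, hd⟩ := hmem ε hε
  refine ⟨s, hs, fun x hx => ?_⟩
  have := (ContinuousMap.dist_apply_le_dist (⟨x, hx⟩ : B)).trans_lt hd
  rw [ContinuousMap.integral_apply hint, dist_comm, Real.dist_eq] at this
  rw [slidingAverage_apply, intervalIntegral.integral_of_le zero_le_one]
  exact this

theorem exists_second_difference_ne_zero {ρ : ℝ → ℝ} (hρ : Continuous ρ)
    (hna : ¬ ∃ a b : ℝ, ∀ x, ρ x = a * x + b) :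
    ∃ x h : ℝ, ρ (x + h + h) - 2 * ρ (x + h) + ρ x ≠ 0 := by
  by_contra! hz
  have hmid (a b : ℝ) : ρ a + ρ b = 2 * ρ ((a + b) / 2) := by
    have := hz a ((b - a) / 2)
    rw [show a + (b - a) / 2 + (b - a) / 2 = b by ring,
      show a + (b - a) / 2 = (a + b) / 2 by ring] at this
    linarith
  let G : ℝ →+ ℝ := AddMonoidHom.mk' (fun x => ρ x - ρ 0) fun a b => by
    have h1 := hmid a b
    have h2 := hmid (a + b) 0
    rw [add_zero] at h2
    linarith
  refine hna ⟨G 1, ρ 0, fun x => ?_⟩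
  have := map_real_smul G (show Continuous G from hρ.sub continuous_const) x 1
  simp only [smul_eq_mul, mul_one] at this
  have hx : G x = ρ x - ρ 0 := rfl
  linarith

theorem pow_mem_of_isLittleO {V : Submodule ℝ C(ℝ, ℝ)} (hcl : IsClosed (V : Set C(ℝ, ℝ)))
    (hV : ∀ a b, ∀ g ∈ V, g.comp (affineCM a b) ∈ V) {e : C(ℝ, ℝ)} (he : e ∈ V)
    {p : ℕ} {α : ℝ} (hα : α ≠ 0)
    (ho : (fun u => e u - α * u ^ p) =o[nhds 0] fun u : ℝ => u ^ p) :
    (ContinuousMap.id ℝ) ^ p ∈ V := by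
  rw [← SetLike.mem_coe, ← hcl.closure_eq, ContinuousMap.mem_closure_iff_forall_isCompact]
  intro B hB ε hε
  obtain ⟨R, hR⟩ := hB.isBounded.exists_norm_le
  obtain ⟨s, -, hs⟩ := exists_rescale_near_pow hα ho R hε
  refine ⟨(α * s ^ p)⁻¹ • e.comp (affineCM s 0), V.smul_mem _ (hV _ _ _ he), fun x hx => ?_⟩
  simpa using hs x (hR x hx)

theorem isLittleO_of_hasDerivAt {ρ : ℝ → ℝ} {c α : ℝ} (h : HasDerivAt ρ α c) :
    (fun u => (ρ (c + u) - ρ c) - α * u ^ 1) =o[nhds 0] fun u : ℝ => u ^ 1 := by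
  simpa [mul_comm] using hasDerivAt_iff_isLittleO_nhds_zero.1 h

/-- A closed affine-invariant space of continuous functions which contains the constants, the
identity and a non-affine function contains the square. -/
theorem sq_mem_of_not_affine {V : Submodule ℝ C(ℝ, ℝ)} (hcl : IsClosed (V : Set C(ℝ, ℝ)))
    (hV : ∀ a b, ∀ g ∈ V, g.comp (affineCM a b) ∈ V) (h1 : (1 : C(ℝ, ℝ)) ∈ V)
    (hid : ContinuousMap.id ℝ ∈ V) {ρ : C(ℝ, ℝ)} (hρ : ρ ∈ V)
    (hna : ¬ ∃ a b : ℝ, ∀ x, ρ x = a * x + b) : (ContinuousMap.id ℝ) ^ 2 ∈ V := by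
  obtain ⟨x₀, h, hΔ⟩ := exists_second_difference_ne_zero ρ.continuous hna
  have hh : h ≠ 0 := by
    rintro rfl
    apply hΔ
    simp only [add_zero]
    ring
  set G := slidingAverage h ρ with hG
  set F := slidingAverage h G with hF
  have hFV : F ∈ V := slidingAverage_mem hcl hV (slidingAverage_mem hcl hV hρ h) h
  have dF : deriv F = fun x => h⁻¹ * (G (x + h) - G x) :=
    funext fun x => (hasDerivAt_slidingAverage hh G x).deriv
  have hd2 (x : ℝ) : HasDerivAt (fun x => h⁻¹ * (G (x + h) - G x))
      (h⁻¹ * (h⁻¹ * (ρ (x + h + h) - ρ (x + h)) - h⁻¹ * (ρ (x + h) - ρ x))) x :=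
    (((hasDerivAt_slidingAverage hh ρ (x + h)).comp_add_const x h).sub
      (hasDerivAt_slidingAverage hh ρ x)).const_mul h⁻¹
  have ddF : deriv (deriv F) =
      fun x => h⁻¹ * (h⁻¹ * (ρ (x + h + h) - ρ (x + h)) - h⁻¹ * (ρ (x + h) - ρ x)) := by
    rw [dF]
    exact funext fun x => (hd2 x).deriv
  have hC2 : ContDiff ℝ 2 F := by
    rw [show (2 : WithTop ℕ∞) = 1 + 1 by norm_num, contDiff_succ_iff_deriv]
    refine ⟨fun x => (hasDerivAt_slidingAverage hh G x).differentiableAt, by simp, ?_⟩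
    rw [contDiff_one_iff_deriv]
    refine ⟨dF ▸ fun x => (hd2 x).differentiableAt, ?_⟩
    rw [ddF]
    fun_prop
  set α : ℝ := deriv (deriv F) x₀ / 2 with hα
  have hα0 : α ≠ 0 := by
    rw [hα, ddF]
    have : h⁻¹ * (h⁻¹ * (ρ (x₀ + h + h) - ρ (x₀ + h)) - h⁻¹ * (ρ (x₀ + h) - ρ x₀))
        = h⁻¹ * h⁻¹ * (ρ (x₀ + h + h) - 2 * ρ (x₀ + h) + ρ x₀) := by ring
    simp only [this]
    have := inv_ne_zero hh
    positivity
  have htaylor := taylor_isLittleO_univ (n := 2) (x₀ := x₀) (by exact_mod_cast hC2)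
  have hshift : Filter.Tendsto (fun u : ℝ => x₀ + u) (nhds 0) (nhds x₀) := by
    simpa using (continuous_const_add x₀).tendsto 0
  have ho := htaylor.comp_tendsto hshift
  refine pow_mem_of_isLittleO hcl hV
    (e := F.comp (affineCM 1 x₀) - F x₀ • 1 - deriv F x₀ • ContinuousMap.id ℝ)
    (V.sub_mem (V.sub_mem (hV _ _ _ hFV) (V.smul_mem _ h1)) (V.smul_mem _ hid)) hα0 ?_
  refine (ho.congr_left fun u => ?_).congr_right fun u => ?_
  · simp [taylorWithinEval_succ, iteratedDerivWithin_univ, iteratedDeriv_succ, iteratedDeriv_zero, hα]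
    ring_nf
  · simp

/-- The span of the functions `x ↦ ρ (a x + b)`. -/
def affineOrbitSpan (ρ : C(ℝ, ℝ)) : Submodule ℝ C(ℝ, ℝ) :=
  Submodule.span ℝ (Set.range fun p : ℝ × ℝ => ρ.comp (affineCM p.1 p.2))

theorem comp_affineCM_mem_closure {ρ g : C(ℝ, ℝ)} (a b : ℝ)
    (hg : g ∈ (affineOrbitSpan ρ).topologicalClosure) :
    g.comp (affineCM a b) ∈ (affineOrbitSpan ρ).topologicalClosure := by
  let T : C(ℝ, ℝ) →L[ℝ] C(ℝ, ℝ) := ContinuousMap.compCLM ℝ ℝ (affineCM a b)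
  have : (affineOrbitSpan ρ).topologicalClosure ≤
      (affineOrbitSpan ρ).topologicalClosure.comap T.toLinearMap := by
    refine Submodule.topologicalClosure_minimal _ (Submodule.span_le.2 ?_)
      ((Submodule.isClosed_topologicalClosure _).preimage T.continuous)
    rintro _ ⟨⟨a', b'⟩, rfl⟩
    refine Submodule.le_topologicalClosure _ (Submodule.subset_span ⟨(a' * a, a' * b + b'), ?_⟩)
    ext x
    simp [T]
    ring_nf
  exact this hg

/-- The affine form `y ↦ v ⬝ y + d` as a continuous map. -/
def affineForm {k : ℕ} (v : Fin k → ℝ) (d : ℝ) : C(Fin k → ℝ, ℝ) :=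
  ⟨fun y => v ⬝ᵥ y + d, by fun_prop⟩

@[simp] theorem affineForm_apply {k : ℕ} (v : Fin k → ℝ) (d : ℝ) (y : Fin k → ℝ) :
    affineForm v d y = v ⬝ᵥ y + d := rfl

/-- One-hidden-layer networks on `ℝ^k`: the span of the ridge functions `y ↦ ρ (v ⬝ y + d)`. -/
def ridgeSpan (ρ : C(ℝ, ℝ)) (k : ℕ) : Submodule ℝ C(Fin k → ℝ, ℝ) :=
  Submodule.span ℝ (Set.range fun p : (Fin k → ℝ) × ℝ => ρ.comp (affineForm p.1 p.2))

theorem comp_affineForm_mem_closure {ρ g : C(ℝ, ℝ)} {k : ℕ} (v : Fin k → ℝ) (d : ℝ)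
    (hg : g ∈ (affineOrbitSpan ρ).topologicalClosure) :
    g.comp (affineForm v d) ∈ (ridgeSpan ρ k).topologicalClosure := by
  let T : C(ℝ, ℝ) →L[ℝ] C(Fin k → ℝ, ℝ) := ContinuousMap.compCLM ℝ ℝ (affineForm v d)
  have : (affineOrbitSpan ρ).topologicalClosure ≤
      (ridgeSpan ρ k).topologicalClosure.comap T.toLinearMap := by
    refine Submodule.topologicalClosure_minimal _ (Submodule.span_le.2 ?_)
      ((Submodule.isClosed_topologicalClosure _).preimage T.continuous)
    rintro _ ⟨⟨a', b'⟩, rfl⟩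
    refine Submodule.le_topologicalClosure _ (Submodule.subset_span ⟨(a' • v, a' * d + b'), ?_⟩)
    ext x
    simp [T]
    ring_nf
  exact this hg

theorem const_mem_ridgeSpan {ρ : C(ℝ, ℝ)} (hna : ¬ ∃ a b : ℝ, ∀ x, ρ x = a * x + b) (k : ℕ)
    (r : ℝ) : ContinuousMap.const _ r ∈ ridgeSpan ρ k := by
  obtain ⟨d, hd⟩ : ∃ d, ρ d ≠ 0 := by
    by_contra! h
    exact hna ⟨0, 0, by simpa using h⟩
  have h : ρ.comp (affineForm (k := k) 0 d) ∈ ridgeSpan ρ k := Submodule.subset_span ⟨(0, d), rfl⟩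
  convert (ridgeSpan ρ k).smul_mem (r / ρ d) h using 1
  ext x
  simp [hd]

theorem one_id_sq_mem_closure {ρ : C(ℝ, ℝ)} (hna : ¬ ∃ a b : ℝ, ∀ x, ρ x = a * x + b) {c α : ℝ}
    (hα : α ≠ 0) (hρ : HasDerivAt ρ α c) :
    (1 : C(ℝ, ℝ)) ∈ (affineOrbitSpan ρ).topologicalClosure ∧
      ContinuousMap.id ℝ ∈ (affineOrbitSpan ρ).topologicalClosure ∧
      (ContinuousMap.id ℝ) ^ 2 ∈ (affineOrbitSpan ρ).topologicalClosure := by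
  set V := (affineOrbitSpan ρ).topologicalClosure with hVdef
  have hcl : IsClosed (V : Set C(ℝ, ℝ)) := Submodule.isClosed_topologicalClosure _
  have hV : ∀ a b, ∀ g ∈ V, g.comp (affineCM a b) ∈ V := fun a b g hg =>
    comp_affineCM_mem_closure a b hg
  have hρV : ρ ∈ V := by
    refine Submodule.le_topologicalClosure _ (Submodule.subset_span ⟨(1, 0), ?_⟩)
    ext x
    simp
  have h1 : (1 : C(ℝ, ℝ)) ∈ V := by
    obtain ⟨d, hd⟩ : ∃ d, ρ d ≠ 0 := by
      by_contra! h
      exact hna ⟨0, 0, by simpa using h⟩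
    convert V.smul_mem (ρ d)⁻¹ (hV 0 d ρ hρV) using 1
    ext x
    simp [hd]
  have hid : ContinuousMap.id ℝ ∈ V := by
    rw [← pow_one (ContinuousMap.id ℝ)]
    refine pow_mem_of_isLittleO hcl hV (e := ρ.comp (affineCM 1 c) - ρ c • 1)
      (V.sub_mem (hV _ _ _ hρV) (V.smul_mem _ h1)) hα ?_
    simpa [add_comm] using isLittleO_of_hasDerivAt hρ
  exact ⟨h1, hid, sq_mem_of_not_affine hcl hV h1 hid hρV hna⟩

/-- The hidden maps computed by stacks of ensemble layers with matrices of rank at most one. -/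
inductive DLoRNet (ρ : ℝ → ℝ) {n : ℕ} : (k : ℕ) → ((Fin n → ℝ) → Fin k → ℝ) → Prop
  | id : DLoRNet ρ n fun x => x
  | layer {k k' L : ℕ} {g : (Fin n → ℝ) → Fin k → ℝ} (hg : DLoRNet ρ k g)
      (A : Fin L → Matrix (Fin k') (Fin k) ℝ) (hA : ∀ l, (A l).rank ≤ 1) (coef : Fin L → ℝ)
      (d : Fin L → Fin k' → ℝ) (b : Fin k' → ℝ) :
      DLoRNet ρ k' fun x => wideLayer ρ L A coef d b (g x)

theorem wideLayer_mul {ρ : ℝ → ℝ} {k₀ k k' L : ℕ} (A : Fin L → Matrix (Fin k') (Fin k) ℝ)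
    (C : Matrix (Fin k) (Fin k₀) ℝ) (coef : Fin L → ℝ) (d : Fin L → Fin k' → ℝ)
    (b : Fin k' → ℝ) (z : Fin k₀ → ℝ) :
    wideLayer ρ L (fun l => A l * C) coef d b z = wideLayer ρ L A coef d b (C.mulVec z) := by
  funext i
  simp [wideLayer, Matrix.mulVec_mulVec]

/-- A single rank-one ensemble layer computes `ρ` of arbitrary one-hidden-layer networks. -/
theorem exists_wideLayer_eq {ρ : C(ℝ, ℝ)} {k k' : ℕ} {s : Fin k' → C(Fin k → ℝ, ℝ)}
    (hs : ∀ i, s i ∈ ridgeSpan ρ k) :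
    ∃ (L : ℕ) (A : Fin L → Matrix (Fin k') (Fin k) ℝ) (coef : Fin L → ℝ)
      (d : Fin L → Fin k' → ℝ) (b : Fin k' → ℝ), (∀ l, (A l).rank ≤ 1) ∧
      ∀ y i, wideLayer ρ L A coef d b y i = ρ (s i y) := by
  have hrep : ∀ i, ∃ (N : ℕ) (a : Fin N → ℝ) (v : Fin N → Fin k → ℝ) (d : Fin N → ℝ),
      ∀ y, s i y = ∑ l, a l * ρ (v l ⬝ᵥ y + d l) := by
    intro i
    obtain ⟨N, a, g, hg⟩ := Submodule.mem_span_set'.1 (hs i)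
    choose p hp using fun l => (g l).2
    refine ⟨N, a, fun l => (p l).1, fun l => (p l).2, fun y => ?_⟩
    rw [← hg, ContinuousMap.sum_apply]
    refine Finset.sum_congr rfl fun l _ => ?_
    rw [ContinuousMap.smul_apply, ← hp]
    simp
  choose N a v d hrep using hrep
  let e : Fin (Fintype.card (Σ i, Fin (N i))) ≃ Σ i, Fin (N i) := (Fintype.equivFin _).symm
  refine ⟨_, fun l => Matrix.vecMulVec (Pi.single (e l).1 1) (v (e l).1 (e l).2),
    fun l => a (e l).1 (e l).2, fun l => Pi.single (e l).1 (d (e l).1 (e l).2),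
    fun i => -∑ q : Σ i, Fin (N i), if q.1 = i then 0 else a q.1 q.2 * ρ 0,
    fun l => Matrix.rank_vecMulVec_le _ _, fun y i => ?_⟩
  unfold wideLayer
  congr 1
  rw [e.sum_comp (fun q : Σ i, Fin (N i) => a q.1 q.2 *
    ρ ((Matrix.vecMulVec (Pi.single q.1 1) (v q.1 q.2)).mulVec y i +
      (Pi.single q.1 (d q.1 q.2) : Fin k' → ℝ) i)), ← sub_eq_add_neg, ← Finset.sum_sub_distrib, hrep,
    Fintype.sum_sigma, Fintype.sum_eq_single i]
  · simp [Matrix.vecMulVec_mulVec]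
  · intro j hj
    refine Finset.sum_eq_zero fun l _ => ?_
    simp [Matrix.vecMulVec_mulVec, hj]

/-- A rank-one ensemble layer followed by a linear readout approximates, uniformly on compact sets,
any tuple of limits of one-hidden-layer networks. -/
theorem exists_wideLayer_near {ρ : C(ℝ, ℝ)} (hna : ¬ ∃ a b : ℝ, ∀ x, ρ x = a * x + b) {c α : ℝ}
    (hα : α ≠ 0) (hρ : HasDerivAt ρ α c) {k k' : ℕ} {Q : Fin k' → C(Fin k → ℝ, ℝ)}
    (hQ : ∀ i, Q i ∈ (ridgeSpan ρ k).topologicalClosure) {B : Set (Fin k → ℝ)} (hB : IsCompact B)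
    {ε : ℝ} (hε : 0 < ε) :
    ∃ (k₁ L : ℕ) (A : Fin L → Matrix (Fin k₁) (Fin k) ℝ) (coef : Fin L → ℝ)
      (d : Fin L → Fin k₁ → ℝ) (b : Fin k₁ → ℝ) (C : Matrix (Fin k') (Fin k₁) ℝ),
      (∀ l, (A l).rank ≤ 1) ∧
      ∀ y ∈ B, ∀ i, |C.mulVec (wideLayer ρ L A coef d b y) i - Q i y| < ε := by
  have happ : ∀ i, ∃ s ∈ ridgeSpan ρ k, ∀ y ∈ B, |s y - Q i y| < ε / 2 := fun i =>
    ContinuousMap.mem_closure_iff_forall_isCompact.1 (hQ i) B hB (ε / 2) (half_pos hε)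
  choose s hs hsQ using happ
  obtain ⟨R, hR⟩ := (hB.image (f := fun y i => s i y) (by fun_prop)).isBounded.exists_norm_le
  obtain ⟨h, hh, happ⟩ := exists_rescale_near_pow hα (isLittleO_of_hasDerivAt hρ) R (half_pos hε)
  have hmem : ∀ i, (Fin.snoc (α := fun _ => C(Fin k → ℝ, ℝ))
      (fun i => ContinuousMap.const _ c + h • s i) (ContinuousMap.const _ c) :
        Fin (k' + 1) → C(Fin k → ℝ, ℝ)) i ∈ ridgeSpan ρ k := by
    intro i
    refine Fin.lastCases ?_ (fun i => ?_) i
    · simpa using const_mem_ridgeSpan hna k c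
    · simpa using add_mem (const_mem_ridgeSpan hna k c) ((ridgeSpan ρ k).smul_mem h (hs i))
  obtain ⟨L, A, coef, d, b, hA, heq⟩ := exists_wideLayer_eq hmem
  refine ⟨k' + 1, L, A, coef, d, b, Matrix.of fun i => Fin.snoc (α := fun _ => ℝ)
    (Pi.single i (α * h ^ 1)⁻¹) (-(α * h ^ 1)⁻¹), hA, fun y hy i => ?_⟩
  have hsy : |s i y| ≤ R :=
    (norm_le_pi_norm (fun i => s i y) i).trans (hR _ ⟨y, hy, rfl⟩)
  have h1 := happ (s i y) hsy
  have h2 := hsQ i y hy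
  have hval : (Matrix.of fun i => Fin.snoc (α := fun _ => ℝ)
      (Pi.single i (α * h ^ 1)⁻¹) (-(α * h ^ 1)⁻¹) : Matrix (Fin k') (Fin (k' + 1)) ℝ).mulVec
        (wideLayer ρ L A coef d b y) i = (α * h ^ 1)⁻¹ * (ρ (c + h * s i y) - ρ c) := by
    rw [Matrix.mulVec, dotProduct, Fin.sum_univ_castSucc]
    simp only [heq, Matrix.of_apply, Fin.snoc_castSucc, Fin.snoc_last, Pi.single_apply]
    simp
    ring
  rw [hval]
  rw [pow_one (s i y)] at h1
  calc _ ≤ _ := abs_sub_le _ (s i y) _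
    _ < ε := by linarith

/-- The tuple `G` is uniformly approximated on `K` by ensemble networks with linear readout. -/
def DLoRApprox (ρ : ℝ → ℝ) {n : ℕ} (K : Set (Fin n → ℝ)) {k : ℕ}
    (G : Fin k → C(Fin n → ℝ, ℝ)) : Prop :=
  ∀ ε > 0, ∃ (k₀ : ℕ) (g : (Fin n → ℝ) → Fin k₀ → ℝ) (C : Matrix (Fin k) (Fin k₀) ℝ),
    DLoRNet ρ k₀ g ∧ ∀ x ∈ K, ∀ i, |C.mulVec (g x) i - G i x| < ε

/-- Postcomposition of a tuple of functions with a function of several variables. -/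
def compTuple {n k : ℕ} (q : C(Fin k → ℝ, ℝ)) (G : Fin k → C(Fin n → ℝ, ℝ)) :
    C(Fin n → ℝ, ℝ) :=
  ⟨fun x => q fun i => G i x, by fun_prop⟩

theorem DLoRApprox.comp {ρ : C(ℝ, ℝ)} (hna : ¬ ∃ a b : ℝ, ∀ x, ρ x = a * x + b) {c α : ℝ}
    (hα : α ≠ 0) (hρ : HasDerivAt ρ α c) {n : ℕ} {K : Set (Fin n → ℝ)} (hK : IsCompact K)
    {k k' : ℕ} {G : Fin k → C(Fin n → ℝ, ℝ)} (hG : DLoRApprox ρ K G)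
    {Q : Fin k' → C(Fin k → ℝ, ℝ)} (hQ : ∀ i, Q i ∈ (ridgeSpan ρ k).topologicalClosure) :
    DLoRApprox ρ K fun i => compTuple (Q i) G := by
  intro ε hε
  obtain ⟨R, hR⟩ := (hK.image (f := fun x i => G i x) (by fun_prop)).isBounded.exists_norm_le
  set B : Set (Fin k → ℝ) := Metric.closedBall 0 (R + 1) with hBdef
  have hB : IsCompact B := isCompact_closedBall _ _
  have hQc : Continuous fun y i => Q i y := by fun_prop
  obtain ⟨δ, hδ, huc⟩ := Metric.uniformContinuousOn_iff.1
    (hB.uniformContinuousOn_of_continuous hQc.continuousOn) (ε / 2) (half_pos hε)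
  obtain ⟨k₁, L, A, coef, d, b, C', hA, hlayer⟩ :=
    exists_wideLayer_near hna hα hρ hQ hB (half_pos hε)
  obtain ⟨k₀, g, C, hg, hgG⟩ := hG (min δ 1) (by positivity)
  refine ⟨k₁, _, C', hg.layer (fun l => A l * C)
    (fun l => (Matrix.rank_mul_le_left _ _).trans (hA l)) coef d b, fun x hx i => ?_⟩
  rw [wideLayer_mul]
  have hGx : ‖fun i => G i x‖ ≤ R := hR _ ⟨x, hx, rfl⟩
  have hdist : dist (C.mulVec (g x)) (fun i => G i x) < min δ 1 := by
    rw [dist_pi_lt_iff (by positivity)]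
    exact fun i => hgG x hx i
  have hmemG : (fun i => G i x) ∈ B := by
    rw [hBdef, mem_closedBall_zero_iff]
    linarith
  have hmem : C.mulVec (g x) ∈ B := by
    rw [hBdef, mem_closedBall_zero_iff]
    have := norm_le_norm_add_norm_sub (fun i => G i x) (C.mulVec (g x))
    rw [← dist_eq_norm, dist_comm] at this
    linarith [hdist.trans_le (min_le_right δ 1)]
  have h1 := hlayer _ hmem i
  have h2 := (dist_le_pi_dist _ _ i).trans_lt
    (huc _ hmem _ hmemG (hdist.trans_le (min_le_left δ 1)))
  rw [Real.dist_eq] at h2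
  calc _ ≤ _ := abs_sub_le _ (Q i (C.mulVec (g x))) _
    _ < ε / 2 + ε / 2 := add_lt_add h1 h2
    _ = ε := add_halves ε

theorem DLoRApprox.coordinates {ρ : ℝ → ℝ} {n : ℕ} {K : Set (Fin n → ℝ)} :
    DLoRApprox ρ K fun i : Fin n => (ContinuousMap.eval i : C(Fin n → ℝ, ℝ)) := fun ε hε =>
  ⟨n, _, 1, .id, fun x _ i => by simpa using hε⟩

theorem eval_mem_closure {ρ : C(ℝ, ℝ)}
    (hid : ContinuousMap.id ℝ ∈ (affineOrbitSpan ρ).topologicalClosure) {k : ℕ} (i : Fin k) :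
    (ContinuousMap.eval i : C(Fin k → ℝ, ℝ)) ∈ (ridgeSpan ρ k).topologicalClosure := by
  convert comp_affineForm_mem_closure (Pi.single i 1) 0 hid using 1
  ext y
  simp

theorem eval_mul_eval_mem_closure {ρ : C(ℝ, ℝ)}
    (hsq : (ContinuousMap.id ℝ) ^ 2 ∈ (affineOrbitSpan ρ).topologicalClosure) {k : ℕ}
    (i j : Fin k) :
    (ContinuousMap.eval i : C(Fin k → ℝ, ℝ)) * (ContinuousMap.eval j : C(Fin k → ℝ, ℝ)) ∈
      (ridgeSpan ρ k).topologicalClosure := by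
  convert Submodule.smul_mem _ (1 / 4 : ℝ) (sub_mem
    (comp_affineForm_mem_closure (Pi.single i 1 + Pi.single j 1) 0 hsq)
    (comp_affineForm_mem_closure (Pi.single i 1 - Pi.single j 1) 0 hsq)) using 1
  ext y
  simp [add_dotProduct, sub_dotProduct]
  ring

/-- The functions in `S` occur jointly among the entries of an approximable tuple. -/
def JointlyDLoRApprox (ρ : ℝ → ℝ) {n : ℕ} (K : Set (Fin n → ℝ)) (S : Set C(Fin n → ℝ, ℝ)) :
    Prop :=
  ∃ (k : ℕ) (G : Fin k → C(Fin n → ℝ, ℝ)), DLoRApprox ρ K G ∧ S ⊆ Set.range G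

theorem DLoRApprox.insert_comp {ρ : C(ℝ, ℝ)} (hna : ¬ ∃ a b : ℝ, ∀ x, ρ x = a * x + b)
    {c α : ℝ} (hα : α ≠ 0) (hρ : HasDerivAt ρ α c) {n : ℕ} {K : Set (Fin n → ℝ)} (hK : IsCompact K)
    {k : ℕ} {G : Fin k → C(Fin n → ℝ, ℝ)} (hG : DLoRApprox ρ K G)
    {S : Set C(Fin n → ℝ, ℝ)} (hS : S ⊆ Set.range G) {q : C(Fin k → ℝ, ℝ)}
    (hq : q ∈ (ridgeSpan ρ k).topologicalClosure) :
    JointlyDLoRApprox ρ K (insert (compTuple q G) S) := by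
  obtain ⟨-, hid, -⟩ := one_id_sq_mem_closure hna hα hρ
  refine ⟨k + 1, _, hG.comp hna hα hρ hK
    (Q := Fin.cons (α := fun _ => C(Fin k → ℝ, ℝ)) q fun i => ContinuousMap.eval i)
    (Fin.cases hq fun i => eval_mem_closure hid i), Set.insert_subset ⟨0, rfl⟩ fun s hs => ?_⟩
  obtain ⟨i, rfl⟩ := hS hs
  exact ⟨i.succ, rfl⟩

theorem JointlyDLoRApprox.insert_of_mem_adjoin {ρ : C(ℝ, ℝ)} (hna : ¬ ∃ a b : ℝ, ∀ x, ρ x = a * x + b)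
    {c α : ℝ} (hα : α ≠ 0) (hρ : HasDerivAt ρ α c) {n : ℕ} {K : Set (Fin n → ℝ)} (hK : IsCompact K)
    {g : C(Fin n → ℝ, ℝ)}
    (hg : g ∈ Algebra.adjoin ℝ
      (Set.range fun i : Fin n => (ContinuousMap.eval i : C(Fin n → ℝ, ℝ))))
    {S : Set C(Fin n → ℝ, ℝ)}
    (hcoord : (Set.range fun i : Fin n => (ContinuousMap.eval i : C(Fin n → ℝ, ℝ))) ⊆ S)
    (hS : JointlyDLoRApprox ρ K S) : JointlyDLoRApprox ρ K (insert g S) := by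
  obtain ⟨-, hid, hsq⟩ := one_id_sq_mem_closure hna hα hρ
  induction hg using Algebra.adjoin_induction generalizing S with
  | mem x hx => rwa [Set.insert_eq_of_mem (hcoord hx)]
  | algebraMap r =>
    obtain ⟨k, G, hG, hSG⟩ := hS
    exact hG.insert_comp hna hα hρ hK hSG
      (Submodule.le_topologicalClosure _ (const_mem_ridgeSpan hna k r))
  | add a b _ _ iha ihb =>
    obtain ⟨k, G, hG, hSG⟩ :=
      ihb (hcoord.trans (Set.subset_insert a S)) (iha hcoord hS)
    obtain ⟨i, rfl⟩ := hSG (Set.mem_insert_of_mem _ (Set.mem_insert _ _))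
    obtain ⟨j, rfl⟩ := hSG (Set.mem_insert _ _)
    exact hG.insert_comp hna hα hρ hK
      (((Set.subset_insert _ _).trans (Set.subset_insert _ _)).trans hSG)
      (add_mem (eval_mem_closure hid i) (eval_mem_closure hid j))
  | mul a b _ _ iha ihb =>
    obtain ⟨k, G, hG, hSG⟩ :=
      ihb (hcoord.trans (Set.subset_insert a S)) (iha hcoord hS)
    obtain ⟨i, rfl⟩ := hSG (Set.mem_insert_of_mem _ (Set.mem_insert _ _))
    obtain ⟨j, rfl⟩ := hSG (Set.mem_insert _ _)
    exact hG.insert_comp hna hα hρ hK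
      (((Set.subset_insert _ _).trans (Set.subset_insert _ _)).trans hSG)
      (eval_mul_eval_mem_closure hsq i j)

theorem DLoRApprox.of_mem_adjoin {ρ : C(ℝ, ℝ)} (hna : ¬ ∃ a b : ℝ, ∀ x, ρ x = a * x + b)
    {c α : ℝ} (hα : α ≠ 0) (hρ : HasDerivAt ρ α c) {n : ℕ} {K : Set (Fin n → ℝ)} (hK : IsCompact K)
    {m : ℕ} {P : Fin m → C(Fin n → ℝ, ℝ)}
    (hP : ∀ i, P i ∈ Algebra.adjoin ℝ
      (Set.range fun i : Fin n => (ContinuousMap.eval i : C(Fin n → ℝ, ℝ)))) :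
    DLoRApprox ρ K P := by
  have hjoint : JointlyDLoRApprox ρ K
      (Set.range P ∪ Set.range fun i : Fin n => (ContinuousMap.eval i : C(Fin n → ℝ, ℝ))) := by
    refine Set.Finite.induction_on_subset (Set.range P) (Set.finite_range P) ?_ ?_
    · exact ⟨n, _, .coordinates, by simp⟩
    · rintro _ T ⟨i, rfl⟩ _ _ hT
      rw [Set.insert_union]
      exact hT.insert_of_mem_adjoin hna hα hρ hK (hP i) Set.subset_union_right
  obtain ⟨k, G, hG, hPG⟩ := hjoint
  choose j hj using fun i => hPG (Or.inl ⟨i, rfl⟩)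
  obtain ⟨-, hid, -⟩ := one_id_sq_mem_closure hna hα hρ
  convert hG.comp hna hα hρ hK (Q := fun i => ContinuousMap.eval (j i))
    fun i => eval_mem_closure hid (j i) using 2 with i
  exact (hj i).symm

/-- `F` is computed from the input map `φ` by a network in the format of a depth, widths and
layer data indexed by the natural numbers. -/
def IsRealized (ρ : ℝ → ℝ) {X : Type*} {k m : ℕ} (φ : X → Fin k → ℝ) (F : X → Fin m → ℝ) : Prop :=
  ∃ (D : ℕ) (w : ℕ → ℕ) (hw : w 0 = k) (Lsz : ℕ → ℕ)
    (A : (j : ℕ) → Fin (Lsz j) → Matrix (Fin (w (j + 1))) (Fin (w j)) ℝ)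
    (coef : (j : ℕ) → Fin (Lsz j) → ℝ) (d : (j : ℕ) → Fin (Lsz j) → Fin (w (j + 1)) → ℝ)
    (b : (j : ℕ) → Fin (w (j + 1)) → ℝ) (C : Matrix (Fin m) (Fin (w D)) ℝ)
    (fs : (j : ℕ) → X → Fin (w j) → ℝ),
    (∀ j l, (A j l).rank ≤ 1) ∧ (∀ x i, fs 0 x i = φ x (Fin.cast hw i)) ∧
    (∀ j x, fs (j + 1) x = wideLayer ρ (Lsz j) (A j) (coef j) (d j) (b j) (fs j x)) ∧
    ∀ x, F x = C.mulVec (fs D x)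

theorem IsRealized.mulVec {ρ : ℝ → ℝ} {X : Type*} {k m : ℕ} (φ : X → Fin k → ℝ)
    (C : Matrix (Fin m) (Fin k) ℝ) : IsRealized ρ φ fun x => C.mulVec (φ x) :=
  ⟨0, fun _ => k, rfl, fun _ => 0, fun _ _ => 0, fun _ _ => 0, fun _ _ => 0, fun _ => 0, C,
    fun j x => (wideLayer ρ 0 (fun _ => 0) (fun _ => 0) (fun _ => 0) 0)^[j] (φ x),
    fun _ _ => by simp, fun _ _ => rfl, fun j x => Function.iterate_succ_apply' _ _ _, fun _ => rfl⟩

theorem IsRealized.of_wideLayer {ρ : ℝ → ℝ} {X : Type*} {k k' m L : ℕ} {φ : X → Fin k → ℝ}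
    {F : X → Fin m → ℝ} (A : Fin L → Matrix (Fin k') (Fin k) ℝ) (hA : ∀ l, (A l).rank ≤ 1)
    (coef : Fin L → ℝ) (d : Fin L → Fin k' → ℝ) (b : Fin k' → ℝ)
    (h : IsRealized ρ (fun x => wideLayer ρ L A coef d b (φ x)) F) : IsRealized ρ φ F := by
  obtain ⟨D, w, rfl, Lsz, As, coefs, ds, bs, C, fs, hAs, h0, hstep, hF⟩ := h
  refine ⟨D + 1, fun j => Nat.casesOn j k w, rfl, fun j => Nat.casesOn j L Lsz,
    fun j => Nat.casesOn j A As, fun j => Nat.casesOn j coef coefs, fun j => Nat.casesOn j d ds,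
    fun j => Nat.casesOn j b bs, C, fun j => Nat.casesOn j φ fs, ?_, fun _ _ => rfl, ?_, hF⟩
  · rintro (_ | j) l
    exacts [hA l, hAs j l]
  · rintro (_ | j) x
    exacts [funext (h0 x), hstep j x]

theorem DLoRNet.isRealized {ρ : ℝ → ℝ} {n k m : ℕ} {g : (Fin n → ℝ) → Fin k → ℝ}
    (hg : DLoRNet ρ k g) {F : (Fin n → ℝ) → Fin m → ℝ} (hF : IsRealized ρ g F) :
    IsRealized ρ (fun x : Fin n → ℝ => x) F := by
  induction hg with
  | id => exact hF
  | layer _ A hA coef d b ih => exact ih (hF.of_wideLayer A hA coef d b)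

/-- Coordinatewise Stone–Weierstrass on a compact set, for a function continuous on that set. -/
theorem exists_adjoin_coordinates_near {n m : ℕ} {K : Set (Fin n → ℝ)} (hK : IsCompact K)
    {f : (Fin n → ℝ) → Fin m → ℝ} (hf : ContinuousOn f K) {ε : ℝ} (hε : 0 < ε) :
    ∃ P : Fin m → C(Fin n → ℝ, ℝ), (∀ i, P i ∈ Algebra.adjoin ℝ
      (Set.range fun i : Fin n => (ContinuousMap.eval i : C(Fin n → ℝ, ℝ)))) ∧
      ∀ x ∈ K, ∀ i, |P i x - f x i| < ε := by
  obtain ⟨F, hF⟩ := ContinuousMap.exists_restrict_eq hK.isClosed ⟨_, hf.domRestrict⟩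
  have hsep : (Algebra.adjoin ℝ
      (Set.range fun i : Fin n => (ContinuousMap.eval i : C(Fin n → ℝ, ℝ)))).SeparatesPoints := by
    intro x y hxy
    obtain ⟨i, hi⟩ := Function.ne_iff.1 hxy
    exact ⟨_, ⟨_, Algebra.subset_adjoin ⟨i, rfl⟩, rfl⟩, hi⟩
  choose P hP hPF using fun i : Fin m =>
    ContinuousMap.exists_mem_subalgebra_near_continuous_of_isCompact_of_separatesPoints hsep
      ((ContinuousMap.eval i).comp F) hK hε
  refine ⟨P, hP, fun x hx i => ?_⟩
  have hFx : F x = f x := DFunLike.congr_fun hF ⟨x, hx⟩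
  simpa [hFx] using hPF i x hx

/-- Wide DLoR universal approximation: for any non-affine continuous
`ρ` differentiable at some `c` with `ρ'(c) ≠ 0`, any compact `K ⊆ ℝ^n`, continuous
`f : K → ℝ^m`, and `ε > 0`, there exist a depth `D`, widths `w`, ensemble sizes,
rank-1 matrices `A j l`, scalars, shift vectors and biases, and a linear readout
`C`, such that the network composed of the parallel DLoR ensemble layers (with
zero-padded input, tracked by the intermediate maps `fs`) approximates `f`
uniformly on `K` within `ε`. -/
theorem stmt13 (ρ : ℝ → ℝ) (hρc : Continuous ρ)
    (hna : ¬ ∃ a b : ℝ, ∀ x, ρ x = a * x + b)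
    (c : ℝ) (hdiff : DifferentiableAt ℝ ρ c) (hd : deriv ρ c ≠ 0)
    (n m : ℕ) (K : Set (Fin n → ℝ)) (hK : IsCompact K)
    (f : (Fin n → ℝ) → Fin m → ℝ) (hf : ContinuousOn f K)
    (ε : ℝ) (hε : 0 < ε) :
    ∃ (D : ℕ) (w : Fin (D + 1) → ℕ) (Lsz : Fin D → ℕ)
      (A : (j : Fin D) → Fin (Lsz j) → Matrix (Fin (w j.succ)) (Fin (w j.castSucc)) ℝ)
      (coef : (j : Fin D) → Fin (Lsz j) → ℝ)
      (dd : (j : Fin D) → Fin (Lsz j) → Fin (w j.succ) → ℝ)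
      (bb : (j : Fin D) → Fin (w j.succ) → ℝ)
      (C : Matrix (Fin m) (Fin (w (Fin.last D))) ℝ)
      (fs : (j : Fin (D + 1)) → (Fin n → ℝ) → Fin (w j) → ℝ),
      (∀ j l, (A j l).rank ≤ 1) ∧
      (∀ x : Fin n → ℝ, fs 0 x = fun i : Fin (w 0) =>
        if h : (i : ℕ) < n then x ⟨i, h⟩ else 0) ∧
      (∀ (j : Fin D) (x : Fin n → ℝ),
        fs j.succ x = wideLayer ρ (Lsz j) (A j) (coef j) (dd j) (bb j) (fs j.castSucc x)) ∧
      (∀ x ∈ K, ‖C.mulVec (fs (Fin.last D) x) - f x‖ < ε) := by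
  obtain ⟨P, hP, hPf⟩ := exists_adjoin_coordinates_near hK hf (half_pos hε)
  obtain ⟨k, g, C₀, hg, hgP⟩ := DLoRApprox.of_mem_adjoin (ρ := ⟨ρ, hρc⟩) hna hd hdiff.hasDerivAt hK
    hP (ε / 2) (half_pos hε)
  obtain ⟨D, w, hw, Lsz, A, coef, d, b, C, fs, hA, h0, hstep, hF⟩ :=
    hg.isRealized (IsRealized.mulVec g C₀)
  refine ⟨D, fun j => w j, fun j => Lsz j, fun j => A j, fun j => coef j, fun j => d j,
    fun j => b j, C, fun j => fs j, fun j => hA j, fun x => funext fun i => ?_,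
    fun j x => hstep j x, fun x hx => ?_⟩
  · have hi : (i : ℕ) < n := i.isLt.trans_eq hw
    rw [dif_pos hi]
    exact h0 x i
  · rw [pi_norm_lt_iff hε]
    intro i
    rw [Real.norm_eq_abs, Pi.sub_apply]
    have h1 := hgP x hx i
    have h2 := hPf x hx i
    have hFx := congrFun (hF x) i
    change |C.mulVec (fs D x) i - f x i| < ε
    rw [← hFx]
    calc _ ≤ _ := abs_sub_le _ (P i x) _
      _ < ε / 2 + ε / 2 := add_lt_add h1 h2
      _ = ε := add_halves ε
end

section
/- Let ρ : ℝ → ℝ be a non-affine continuous function that is differentiable at some point c ∈ ℝ with ρ'(c) ≠ 0, applied componentwise. Let K be a compact subset of ℝ^W, and let g : K → ℝ^W be a dense feedforward network of depth L and width W, g = ℒ_L ∘ ... ∘ ℒ_1 with layers ℒ_k(z) = ρ(W_k z + b_k), W_k ∈ ℝ^{W×W}, b_k ∈ ℝ^W. Suppose g uniformly ε-approximates a target function f on K: sup_{x ∈ K} ‖g(x) − f(x)‖ ≤ ε. Then for every δ > 0 there exists a DLoR network g̃ of width W and depth at most L·W — obtained by replacing each dense layer with a multiplicative block of at most W layers whose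 weight matrices all have the form α I_W + u vᵀ — such that sup_{x ∈ K} ‖g̃(x) − f(x)‖ ≤ ε + δ. In particular, any uniform approximation guarantee for dense full-rank networks transfers to structurally constrained DLoR networks of the same width. -/
/-- Forward pass of a dense feedforward network on `ℝ^W`: each layer is a pair
`(W_k, b_k)` and computes `z ↦ ρ(W_k z + b_k)` componentwise; the layers are applied
in list order (`ℒ_L ∘ ⋯ ∘ ℒ_1` for the list `[ℒ_1, …, ℒ_L]`). -/
noncomputable def denseForward (ρ : ℝ → ℝ) {N : ℕ}
    (layers : List (Matrix (Fin N) (Fin N) ℝ × (Fin N → ℝ))) (z : Fin N → ℝ) :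
    Fin N → ℝ :=
  layers.foldl (fun s p => fun i => ρ (p.1.mulVec s i + p.2 i)) z

open Filter Topology Matrix

/-- A matrix of the form `α I + u vᵀ`. -/
def IsDLoR {N : ℕ} (M : Matrix (Fin N) (Fin N) ℝ) : Prop :=
  ∃ (α : ℝ) (u v : Fin N → ℝ), M = α • (1 : Matrix (Fin N) (Fin N) ℝ) + vecMulVec u v

lemma IsDLoR.smul {N : ℕ} {M : Matrix (Fin N) (Fin N) ℝ} (hM : IsDLoR M) (s : ℝ) :
    IsDLoR (s • M) := by
  obtain ⟨α, u, v, rfl⟩ := hM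
  exact ⟨s * α, s • u, v, by rw [smul_add, smul_smul, smul_vecMulVec]⟩

lemma isUnit_one_add_vecMulVec {N : ℕ} {u v : Fin N → ℝ} (h : 1 + v ⬝ᵥ u ≠ 0) :
    IsUnit (1 + vecMulVec u v : Matrix (Fin N) (Fin N) ℝ) := by
  rw [← mulVec_injective_iff_isUnit]
  refine (injective_iff_map_eq_zero (mulVecLin (1 + vecMulVec u v))).2 fun x hx => ?_
  rw [mulVecLin_apply, add_mulVec, one_mulVec, vecMulVec_mulVec, op_smul_eq_smul] at hx
  have h1 : (v ⬝ᵥ x) * (1 + v ⬝ᵥ u) = 0 := by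
    have := congrArg (v ⬝ᵥ ·) hx
    simp only [dotProduct_add, dotProduct_smul, smul_eq_mul, dotProduct_zero] at this
    linarith
  have h2 := (mul_eq_zero.1 h1).resolve_right h
  simpa [h2] using hx

/-- If an invertible matrix `B` fixes the first `k` standard basis vectors, then the vector
`B e_k` has a nonzero entry among those of index at least `k`. -/
lemma exists_col_ne_zero_of_fixes {N : ℕ} {B : Matrix (Fin N) (Fin N) ℝ} (hB : IsUnit B)
    (k : Fin N) (hfix : ∀ j < k, B *ᵥ Pi.single j 1 = Pi.single j 1) :
    ∃ j, k ≤ j ∧ (B *ᵥ Pi.single k 1) j ≠ 0 := by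
  by_contra! hz
  set w := B *ᵥ Pi.single k 1 with hw
  have hsum : w = ∑ j ∈ Finset.univ.filter (· < k), w j • (Pi.single j 1 : Fin N → ℝ) := by
    ext i
    simp only [Finset.sum_apply, Pi.smul_apply, Pi.single_apply, smul_eq_mul, mul_ite, mul_one,
      mul_zero, Finset.sum_ite_eq, Finset.mem_filter, Finset.mem_univ, true_and]
    split_ifs with h
    · rfl
    · exact hz i (not_lt.1 h)
  have hBw : B *ᵥ w = w := by
    conv_lhs => rw [hsum]
    conv_rhs => rw [hsum]
    rw [← mulVecLin_apply, map_sum]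
    refine Finset.sum_congr rfl fun j hj => ?_
    rw [map_smul, mulVecLin_apply, hfix j (Finset.mem_filter.1 hj).2]
  have hinj := mulVec_injective_iff_isUnit.2 hB
  have hwe : w = Pi.single k 1 := hinj hBw
  have := hz k le_rfl
  rw [hwe] at this
  simp at this

/-- There is a covector annihilating `e_j` for `j < k`, equal to `1` on `e_k`, and nonzero on a
given vector with a nonzero entry of index at least `k`. -/
lemma exists_covector {N : ℕ} (k : Fin N) (w : Fin N → ℝ) (hw : ∃ j, k ≤ j ∧ w j ≠ 0) :
    ∃ v : Fin N → ℝ, (∀ j < k, v j = 0) ∧ v k = 1 ∧ v ⬝ᵥ w ≠ 0 := by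
  by_cases hk : w k = 0
  · obtain ⟨j, hkj, hj⟩ := hw
    have hne : j ≠ k := by rintro rfl; exact hj hk
    refine ⟨Pi.single k 1 + Pi.single j 1, fun i hi => ?_, ?_, ?_⟩
    · simp [hi.ne, (hi.trans_le hkj).ne]
    · simp [hne.symm]
    · simpa [add_dotProduct, hk] using hj
  · exact ⟨Pi.single k 1, fun i hi => by simp [hi.ne], by simp, by simpa using hk⟩

lemma exists_dlor_list_mul {N : ℕ} {A : Matrix (Fin N) (Fin N) ℝ} (hA : IsUnit A) (k : ℕ)
    (hk : k ≤ N) :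
    ∃ (l : List (Matrix (Fin N) (Fin N) ℝ)) (B : Matrix (Fin N) (Fin N) ℝ),
      l.length = k ∧ (∀ P ∈ l, IsDLoR P) ∧ IsUnit B ∧ A = l.prod * B ∧
      ∀ j : Fin N, (j : ℕ) < k → B *ᵥ Pi.single j 1 = Pi.single j 1 := by
  induction k with
  | zero => exact ⟨[], A, rfl, by simp, hA, by simp, by simp⟩
  | succ k ih =>
    obtain ⟨l, B, hl, hlD, hB, hAB, hfix⟩ := ih (by omega)
    let e : Fin N := ⟨k, hk⟩
    obtain ⟨v, hv0, hv1, hvw⟩ := exists_covector e _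
      (exists_col_ne_zero_of_fixes hB e fun j hj => hfix j hj)
    set w := B *ᵥ Pi.single e 1 with hw
    set P : Matrix (Fin N) (Fin N) ℝ := 1 + vecMulVec (w - Pi.single e 1) v with hP
    have hPu : IsUnit P := isUnit_one_add_vecMulVec (by simpa [dotProduct_sub, hv1] using hvw)
    have hdet := (isUnit_iff_isUnit_det P).1 hPu
    have hPx : ∀ x, P *ᵥ x = x + (v ⬝ᵥ x) • (w - Pi.single e 1) := fun x => by
      rw [hP, add_mulVec, one_mulVec, vecMulVec_mulVec, op_smul_eq_smul]
    have key : ∀ x y, P *ᵥ y = x → P⁻¹ *ᵥ x = y := by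
      rintro _ y rfl
      rw [mulVec_mulVec, nonsing_inv_mul _ hdet, one_mulVec]
    refine ⟨l ++ [P], P⁻¹ * B, by simp [hl], ?_, ?_, ?_, fun j hj => ?_⟩
    · intro Q hQ
      rcases List.mem_append.1 hQ with h | h
      · exact hlD Q h
      · rw [List.mem_singleton.1 h]
        exact ⟨1, _, _, by rw [one_smul]⟩
    · exact ((isUnit_nonsing_inv_iff).2 hPu).mul hB
    · rw [List.prod_append, List.prod_singleton, mul_assoc, mul_nonsing_inv_cancel_left _ _ hdet,
        hAB]
    · rw [← mulVec_mulVec]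
      rcases Nat.lt_succ_iff_lt_or_eq.1 hj with h | h
      · rw [hfix j h]
        refine key _ _ ?_
        rw [hPx, dotProduct_single, hv0 j h]
        simp
      · obtain rfl : j = e := Fin.ext h
        refine key _ _ ?_
        rw [hPx, dotProduct_single, hv1]
        simp [hw]

/-- Every invertible `N × N` matrix is a product of `N` matrices of the form `α I + u vᵀ`. -/
theorem exists_dlor_list_prod {N : ℕ} {A : Matrix (Fin N) (Fin N) ℝ} (hA : IsUnit A) :
    ∃ l : List (Matrix (Fin N) (Fin N) ℝ),
      l.length = N ∧ (∀ P ∈ l, IsDLoR P) ∧ A = l.prod := by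
  obtain ⟨l, B, hl, hD, -, hAB, hfix⟩ := exists_dlor_list_mul hA N le_rfl
  have hB : B = 1 := ext_of_mulVec_single fun j => by rw [hfix j j.2, one_mulVec]
  exact ⟨l, hl, hD, by rw [hAB, hB, mul_one]⟩

lemma eventually_isUnit_sub_smul_one {N : ℕ} (A : Matrix (Fin N) (Fin N) ℝ) :
    ∀ᶠ t : ℝ in 𝓝[≠] 0, IsUnit (A - t • (1 : Matrix (Fin N) (Fin N) ℝ)) := by
  have h := (A.finite_spectrum.subset (Set.sdiff_subset (t := {0}))).isClosed.isOpen_compl.mem_nhds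
    (x := (0 : ℝ)) (by simp)
  filter_upwards [nhdsWithin_le_nhds h, self_mem_nhdsWithin] with t ht ht0
  have : t ∉ spectrum ℝ A := fun hs => ht ⟨hs, ht0⟩
  rw [spectrum.notMem_iff, Algebra.algebraMap_eq_smul_one] at this
  simpa using this.neg

/-- `G` is a limit, uniformly on compact sets, of DLoR networks of depth at most `n`. -/
def DLoRApproximable (ρ : ℝ → ℝ) {N : ℕ} (n : ℕ) (G : (Fin N → ℝ) → Fin N → ℝ) : Prop :=
  ∀ K : Set (Fin N → ℝ), IsCompact K → ∀ ε > (0 : ℝ),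
    ∃ layers : List (ℝ × (Fin N → ℝ) × (Fin N → ℝ) × (Fin N → ℝ)),
      layers.length ≤ n ∧ ∀ x ∈ K, ‖dlorForward ρ layers x - G x‖ ≤ ε

namespace DLoRApproximable

variable {ρ : ℝ → ℝ} {N n : ℕ} {G : (Fin N → ℝ) → Fin N → ℝ}

lemma id : DLoRApproximable ρ 0 (fun x : Fin N → ℝ => x) :=
  fun _ _ ε hε => ⟨[], le_rfl, fun x _ => by simpa [dlorForward] using hε.le⟩

lemma comp_layer (hρ : Continuous ρ) (hG : DLoRApproximable ρ n G)
    {P : Matrix (Fin N) (Fin N) ℝ} (hP : IsDLoR P) (b : Fin N → ℝ) :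
    DLoRApproximable ρ (n + 1) (fun x => G (fun i => ρ ((P *ᵥ x) i + b i))) := by
  obtain ⟨α, u, v, rfl⟩ := hP
  intro K hK ε hε
  obtain ⟨l, hl, hlK⟩ := hG ((fun x => fun i =>
    ρ (((α • (1 : Matrix (Fin N) (Fin N) ℝ) + vecMulVec u v) *ᵥ x) i + b i)) '' K)
    (hK.image (by fun_prop)) ε hε
  exact ⟨(α, u, v, b) :: l, by simpa using hl, fun x hx => hlK _ (Set.mem_image_of_mem _ hx)⟩

lemma of_continuous_family {F : ℝ → (Fin N → ℝ) → Fin N → ℝ}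
    (hF : Continuous (Function.uncurry F)) (h : ∀ᶠ t in 𝓝[≠] 0, DLoRApproximable ρ n (F t)) :
    DLoRApproximable ρ n (F 0) := by
  intro K hK ε hε
  have hc : ∀ᶠ t in 𝓝 (0 : ℝ), ∀ x ∈ K, ‖F t x - F 0 x‖ < ε / 2 := by
    refine hK.eventually_forall_of_forall_eventually fun y _ => ?_
    have hcont : Continuous fun z : ℝ × (Fin N → ℝ) => ‖F z.1 z.2 - F 0 z.2‖ :=
      (hF.sub (hF.comp (continuous_const.prodMk continuous_snd))).norm
    exact hcont.continuousAt.eventually_lt continuousAt_const (by simpa using half_pos hε)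
  obtain ⟨t, ht, htc⟩ := (h.and (nhdsWithin_le_nhds hc)).exists
  obtain ⟨l, hl, hlK⟩ := ht K hK (ε / 2) (half_pos hε)
  refine ⟨l, hl, fun x hx => ?_⟩
  have := norm_sub_le_norm_sub_add_norm_sub (dlorForward ρ l x) (F t x) (F 0 x)
  linarith [hlK x hx, htc x hx]

/-- A DLoR linear map can be prepended at the cost of one layer, provided that affine
rescalings can be absorbed. -/
lemma comp_mulVec (hρ : Continuous ρ) {c : ℝ} (hdiff : DifferentiableAt ℝ ρ c)
    (hd : deriv ρ c ≠ 0) (hGc : Continuous G)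
    (hG : ∀ (s : ℝ) (d : Fin N → ℝ), DLoRApproximable ρ n (fun x => G (s • x + d)))
    {P : Matrix (Fin N) (Fin N) ℝ} (hP : IsDLoR P) (s : ℝ) (d : Fin N → ℝ) :
    DLoRApproximable ρ (n + 1) (fun x => G (P *ᵥ (s • x + d))) := by
  have hds : Continuous (dslope ρ c) := by
    rw [← continuousOn_univ, continuousOn_dslope univ_mem]
    exact ⟨hρ.continuousOn, hdiff⟩
  let F : ℝ → (Fin N → ℝ) → Fin N → ℝ := fun h x => G fun i =>
    dslope ρ c (c + h * (P *ᵥ (s • x + d)) i) * (P *ᵥ (s • x + d)) i / deriv ρ c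
  have hF : Continuous (Function.uncurry F) := by
    refine hGc.comp (continuous_pi fun i => ?_)
    have : Continuous fun z : ℝ × (Fin N → ℝ) => (P *ᵥ (s • z.2 + d)) i := by fun_prop
    exact ((hds.comp (continuous_const.add (continuous_fst.mul this))).mul this).div_const _
  have h0 : F 0 = fun x => G (P *ᵥ (s • x + d)) := by
    funext x
    simp [F, mul_div_cancel_left₀ _ hd]
  rw [← h0]
  refine of_continuous_family hF ?_
  filter_upwards [self_mem_nhdsWithin] with h hh
  have hh : h ≠ 0 := hh
  convert (hG (h * deriv ρ c)⁻¹ (fun _ => -((h * deriv ρ c)⁻¹ * ρ c))).comp_layer hρ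
    (hP.smul (h * s)) (fun i => c + h * (P *ᵥ d) i) using 1
  funext x
  simp only [F]
  congr 1
  funext i
  set y := (P *ᵥ (s • x + d)) i with hy
  have hy' : (((h * s) • P) *ᵥ x) i + (c + h * (P *ᵥ d) i) = c + h * y := by
    rw [hy, mulVec_add, mulVec_smul, smul_mulVec]
    simp only [Pi.add_apply, Pi.smul_apply, smul_eq_mul]
    ring
  have hslope : h * y * dslope ρ c (c + h * y) = ρ (c + h * y) - ρ c := by
    simpa using sub_smul_dslope ρ c (c + h * y)
  simp only [Pi.add_apply, Pi.smul_apply, smul_eq_mul]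
  rw [hy']
  field_simp
  linarith

lemma comp_list_prod (hρ : Continuous ρ) {c : ℝ} (hdiff : DifferentiableAt ℝ ρ c)
    (hd : deriv ρ c ≠ 0) (hGc : Continuous G)
    (hG : ∀ (s : ℝ) (d : Fin N → ℝ), DLoRApproximable ρ n (fun x => G (s • x + d)))
    (l : List (Matrix (Fin N) (Fin N) ℝ)) (hl : ∀ P ∈ l, IsDLoR P) (s : ℝ) (d : Fin N → ℝ) :
    DLoRApproximable ρ (n + l.length) (fun x => G (l.prod *ᵥ (s • x + d))) := by
  induction l generalizing n G s d with
  | nil => simpa using hG s d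
  | cons P l ih =>
    have := ih (G := fun x => G (P *ᵥ x)) (by fun_prop)
      (fun s d => comp_mulVec hρ hdiff hd hGc hG (hl P (by simp)) s d)
      (fun Q hQ => hl Q (by simp [hQ])) s d
    rw [List.length_cons, List.prod_cons, Nat.add_comm l.length, ← Nat.add_assoc]
    simpa only [mulVec_mulVec] using this

lemma comp_isUnit_layer (hρ : Continuous ρ) {c : ℝ} (hdiff : DifferentiableAt ℝ ρ c)
    (hd : deriv ρ c ≠ 0) (hN : N ≠ 0) (hGc : Continuous G) (hG : DLoRApproximable ρ n G)
    {A : Matrix (Fin N) (Fin N) ℝ} (hA : IsUnit A) (b : Fin N → ℝ) :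
    DLoRApproximable ρ (n + N) (fun x => G (fun i => ρ ((A *ᵥ x) i + b i))) := by
  obtain ⟨l, hlen, hl, rfl⟩ := exists_dlor_list_prod hA
  obtain _ | ⟨P, l⟩ := l
  · exact absurd hlen.symm hN
  have hP : IsDLoR P := hl P (by simp)
  have := comp_list_prod (n := n + 1) (G := fun x => G (fun i => ρ ((P *ᵥ x) i + b i)))
    hρ hdiff hd (by fun_prop) (fun s d => ?_) l (fun Q hQ => hl Q (by simp [hQ])) 1 0
  · rw [List.length_cons] at hlen
    rw [show n + N = n + 1 + l.length by omega, List.prod_cons]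
    simpa only [mulVec_mulVec, one_smul, add_zero] using this
  · convert hG.comp_layer hρ (hP.smul s) (P *ᵥ d + b) using 5 with x i
    rw [mulVec_add, mulVec_smul, smul_mulVec]
    simp only [Pi.add_apply]
    ring

lemma comp_dense_layer (hρ : Continuous ρ) {c : ℝ} (hdiff : DifferentiableAt ℝ ρ c)
    (hd : deriv ρ c ≠ 0) (hN : N ≠ 0) (hGc : Continuous G) (hG : DLoRApproximable ρ n G)
    (A : Matrix (Fin N) (Fin N) ℝ) (b : Fin N → ℝ) :
    DLoRApproximable ρ (n + N) (fun x => G (fun i => ρ ((A *ᵥ x) i + b i))) := by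
  have := of_continuous_family (ρ := ρ) (n := n + N)
    (F := fun t x => G (fun i => ρ (((A - t • (1 : Matrix (Fin N) (Fin N) ℝ)) *ᵥ x) i + b i)))
    ?_ ?_
  · simpa using this
  · simp only [Function.uncurry_def, sub_mulVec, smul_mulVec, one_mulVec]
    fun_prop
  · filter_upwards [eventually_isUnit_sub_smul_one A] with t ht
    exact comp_isUnit_layer hρ hdiff hd hN hGc hG ht b

end DLoRApproximable

lemma continuous_denseForward {ρ : ℝ → ℝ} (hρ : Continuous ρ) {N : ℕ}
    (layers : List (Matrix (Fin N) (Fin N) ℝ × (Fin N → ℝ))) :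
    Continuous (denseForward ρ layers) := by
  induction layers with
  | nil => exact continuous_id
  | cons p l ih =>
    exact ih.comp (g := denseForward ρ l) (f := fun x i => ρ ((p.1 *ᵥ x) i + p.2 i)) (by fun_prop)

/-- A dense network of width `N` and depth `L` is a limit, uniformly on compact sets, of DLoR
networks of width `N` and depth at most `L * N`. -/
theorem dlorApproximable_denseForward {ρ : ℝ → ℝ} (hρ : Continuous ρ) {c : ℝ}
    (hdiff : DifferentiableAt ℝ ρ c) (hd : deriv ρ c ≠ 0) {N : ℕ} (hN : N ≠ 0)
    (layers : List (Matrix (Fin N) (Fin N) ℝ × (Fin N → ℝ))) :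
    DLoRApproximable ρ (layers.length * N) (denseForward ρ layers) := by
  induction layers with
  | nil =>
    rw [List.length_nil, Nat.zero_mul]
    exact DLoRApproximable.id
  | cons p l ih =>
    rw [List.length_cons, Nat.succ_mul]
    exact DLoRApproximable.comp_dense_layer hρ hdiff hd hN (continuous_denseForward hρ l) ih p.1 p.2

/-- General UAT transfer: if a dense feedforward network of depth `L`
and width `W`, with non-affine continuous activation `ρ` differentiable at some `c`
with `ρ'(c) ≠ 0`, uniformly `ε`-approximates a target `f` on a compact `K ⊆ ℝ^W`,
then for every `δ > 0` there is a DLoR network of the same width and depth at most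
`L * W` (every weight matrix of the form `α I + u vᵀ`) that uniformly
`(ε + δ)`-approximates `f` on `K`. -/
theorem stmt14 (ρ : ℝ → ℝ) (hρc : Continuous ρ)
    (hna : ¬ ∃ a b : ℝ, ∀ x, ρ x = a * x + b)
    (c : ℝ) (hdiff : DifferentiableAt ℝ ρ c) (hd : deriv ρ c ≠ 0)
    (Wd : ℕ) (K : Set (Fin Wd → ℝ)) (hK : IsCompact K)
    (L : ℕ) (Wk : Fin L → Matrix (Fin Wd) (Fin Wd) ℝ) (bk : Fin L → Fin Wd → ℝ)
    (f : (Fin Wd → ℝ) → Fin Wd → ℝ) (ε : ℝ)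
    (happrox : ∀ x ∈ K,
      ‖denseForward ρ (List.ofFn fun k => (Wk k, bk k)) x - f x‖ ≤ ε) :
    ∀ δ > (0 : ℝ),
      ∃ layers : List (ℝ × (Fin Wd → ℝ) × (Fin Wd → ℝ) × (Fin Wd → ℝ)),
        layers.length ≤ L * Wd ∧
        ∀ x ∈ K, ‖dlorForward ρ layers x - f x‖ ≤ ε + δ := by
  intro δ hδ
  rcases eq_or_ne Wd 0 with rfl | hW
  · refine ⟨[], by simp, fun x hx => ?_⟩
    have h := happrox x hx
    rw [Subsingleton.elim (denseForward ρ _ x) (dlorForward ρ [] x)] at h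
    linarith
  · obtain ⟨l, hl, hlK⟩ := dlorApproximable_denseForward hρc hdiff hd hW
      (List.ofFn fun k => (Wk k, bk k)) K hK δ hδ
    refine ⟨l, by simpa using hl, fun x hx => ?_⟩
    have := norm_sub_le_norm_sub_add_norm_sub (dlorForward ρ l x)
      (denseForward ρ (List.ofFn fun k => (Wk k, bk k)) x) (f x)
    linarith [hlK x hx, happrox x hx]
end
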